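/- arXiv:1612.06713 — 2 statements merged into one kernel-verified Lean document; each statement's English description precedes it below -/
import Mathlib

section
/- Let 𝓛 = (L_1, …, L_m) be an m-tuple of Z_K-lattices in V and let 𝓛' = (L_i)_{i∈T} be the subtuple corresponding to a nonempty subset T of {1, …, m}. Then the class number of 𝓛' is at most the class number of 𝓛. -/
/-
STATEMENT 3: Let 𝓛 = (L_1, …, L_m) be an m-tuple of Z_K-lattices in V and let
𝓛' = (L_i)_{i∈T} be the subtuple corresponding to a nonempty subset T of
{1, …, m}.  Then the class number of 𝓛' is at most the class number of 𝓛.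
-/

set_option maxHeartbeats 1000000
set_option synthInstance.maxHeartbeats 1000000

open NumberField IsDedekindDomain TensorProduct
open scoped nonZeroDivisors

noncomputable instance adicSMulCommClass {K : Type*} [Field K] [NumberField K]
    (v : HeightOneSpectrum (𝓞 K)) :
    SMulCommClass K (v.adicCompletion K) (v.adicCompletion K) :=
  Algebra.to_smulCommClass

variable {K : Type*} [Field K] [NumberField K]
variable {V : Type*} [AddCommGroup V] [Module K V]
  [Module (𝓞 K) V] [IsScalarTower (𝓞 K) K V]

/-- The `Z_{K_p}`-submodule of `V_p = K_p ⊗ V` generated by (the image of) a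
`Z_K`-submodule `N` of `V`. -/
noncomputable def latCompletion (v : HeightOneSpectrum (𝓞 K)) (N : Submodule (𝓞 K) V) :
    Submodule ((v.adicCompletionIntegers K).toSubring) ((v.adicCompletion K) ⊗[K] V) :=
  Submodule.span _ ((fun x : V => (1 : v.adicCompletion K) ⊗ₜ[K] x) '' (N : Set V))

/-- `N` is a `Z_K`-lattice in `V`: a finitely generated `Z_K`-submodule
containing a `K`-basis of `V`. -/
def IsZLat (N : Submodule (𝓞 K) V) : Prop :=
  N.FG ∧ Submodule.span K (N : Set V) = ⊤

/-- Two tuples of `Z_K`-lattices are in the same genus: for every maximal ideal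
(height-one prime) `v` of `Z_K` there is an isometry of the completed space
`(V_v, Φ_v)` carrying the completions of the members of one tuple to those of
the other. -/
def SameGenus (Φ : LinearMap.BilinForm K V) {ι : Type*}
    (L L' : ι → Submodule (𝓞 K) V) : Prop :=
  ∀ v : HeightOneSpectrum (𝓞 K),
    ∃ g : ((v.adicCompletion K) ⊗[K] V) ≃ₗ[v.adicCompletion K]
        ((v.adicCompletion K) ⊗[K] V),
      (∀ x y, Φ.baseChange (v.adicCompletion K) (g x) (g y) =
        Φ.baseChange (v.adicCompletion K) x y) ∧
      ∀ i, ⇑g '' ((latCompletion v (L i) : Set _)) = (latCompletion v (L' i) : Set _)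

/-- Two tuples of `Z_K`-lattices are isometric: some isometry of `(V, Φ)` maps
each member of the first tuple onto the corresponding member of the second. -/
def IsIsom (Φ : LinearMap.BilinForm K V) {ι : Type*}
    (L L' : ι → Submodule (𝓞 K) V) : Prop :=
  ∃ g : V ≃ₗ[K] V, (∀ x y, Φ (g x) (g y) = Φ x y) ∧
    ∀ i, ⇑g '' ((L i : Set V)) = ((L' i : Set V))

/-- The genus of a tuple of lattices, as a set of tuples of lattices. -/
def genusSet (Φ : LinearMap.BilinForm K V) {ι : Type*}
    (L : ι → Submodule (𝓞 K) V) : Set (ι → Submodule (𝓞 K) V) :=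
  {L' | (∀ i, IsZLat (L' i)) ∧ SameGenus Φ L L'}

/-- The class number of a tuple of lattices: the number of isometry classes in
its genus. -/
noncomputable def classNumber (Φ : LinearMap.BilinForm K V) {ι : Type*}
    (L : ι → Submodule (𝓞 K) V) : ℕ :=
  Nat.card (Quot (fun X Y : genusSet Φ L => IsIsom Φ X.1 Y.1))


set_option linter.unusedSectionVars false
section helpers

theorem exists_away (v : HeightOneSpectrum (𝓞 K)) (d : 𝓞 K) (hd : d ≠ 0) :
    ∃ e : 𝓞 K, v.intValuation e = 1 ∧
      ∀ w : HeightOneSpectrum (𝓞 K), w ≠ v → w.intValuation e ≤ w.intValuation d := by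
  have hI : Ideal.span {d} ≠ (0 : Ideal (𝓞 K)) := by
    simpa using hd
  have hfin : FiniteMultiplicity v.asIdeal (Ideal.span {d}) :=
    FiniteMultiplicity.of_not_isUnit (fun h => v.isPrime.ne_top (by simpa using h)) hI
  obtain ⟨J, hJ, hJv⟩ := hfin.exists_eq_pow_mul_and_not_dvd
  have hJv' : ¬ J ≤ v.asIdeal := fun h => hJv (Ideal.dvd_iff_le.mpr h)
  obtain ⟨e, heJ, hev⟩ := SetLike.not_le_iff_exists.mp hJv'
  refine ⟨e, (v.intValuation_eq_one_iff).mpr hev, fun w hw => ?_⟩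
  have hvw : ¬ v.asIdeal ≤ w.asIdeal := by
    intro h
    apply hw
    have := v.isMaximal.eq_of_le w.isPrime.ne_top h
    exact HeightOneSpectrum.ext this.symm
  obtain ⟨f, hfv, hfw⟩ := SetLike.not_le_iff_exists.mp hvw
  set n := multiplicity v.asIdeal (Ideal.span {d})
  have h1 : f ^ n * e ∈ Ideal.span {d} := by
    rw [hJ]
    exact Ideal.mul_mem_mul (Ideal.pow_mem_pow hfv n) heJ
  obtain ⟨c, hc⟩ := Ideal.mem_span_singleton'.mp h1
  have h2 := congrArg w.intValuation hc
  rw [map_mul, map_mul, map_pow, (w.intValuation_eq_one_iff).mpr hfw, one_pow, one_mul] at h2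
  rw [← h2]
  exact mul_le_of_le_one_left' (w.intValuation_le_one c)

theorem val_algebraMap (v : HeightOneSpectrum (𝓞 K)) (r : 𝓞 K) :
    Valued.v (algebraMap K (v.adicCompletion K) (algebraMap (𝓞 K) K r)) = v.intValuation r := by
  rw [← v.valuation_of_algebraMap (K := K)]
  exact v.valuedAdicCompletion_eq_valuation' _

theorem exists_approx (v : HeightOneSpectrum (𝓞 K)) (d : 𝓞 K) (hd : d ≠ 0)
    (c : v.adicCompletion K) (hc : c ∈ v.adicCompletionIntegers K) :
    ∃ a : 𝓞 K, Valued.v (c - algebraMap K (v.adicCompletion K) (algebraMap (𝓞 K) K a)) ≤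
        v.intValuation d ∧
      ∀ w : HeightOneSpectrum (𝓞 K), w ≠ v → w.intValuation a ≤ w.intValuation d := by
  have hd0 : v.intValuation d ≠ 0 := v.intValuation_ne_zero d hd
  have hd1 : v.intValuation d ≤ 1 := v.intValuation_le_one d
  rw [HeightOneSpectrum.mem_adicCompletionIntegers] at hc
  obtain ⟨k, hk⟩ : ∃ k : K, Valued.v (c - algebraMap K (v.adicCompletion K) k) <
      v.intValuation d := by
    have hopen : IsOpen {x : v.adicCompletion K | Valued.v (c - x) < v.intValuation d} := by
      have h := Valued.isOpen_ball (v.adicCompletion K)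
        (Valued.v.restrict (algebraMap K (v.adicCompletion K) (algebraMap (𝓞 K) K d)))
      simp only [Valuation.restrict_lt_iff, val_algebraMap] at h
      exact h.preimage (continuous_const.sub continuous_id)
    obtain ⟨k, hk⟩ := (v.denseRange_algebraMap K).exists_mem_open hopen
      ⟨c, by simp [zero_lt_iff, hd0]⟩
    exact ⟨k, hk⟩
  have hk1 : v.valuation K k ≤ 1 := by
    rw [← v.valuedAdicCompletion_eq_valuation' k]
    have : algebraMap K (v.adicCompletion K) k = c - (c - algebraMap K (v.adicCompletion K) k) := by
      ring
    change Valued.v (algebraMap K (v.adicCompletion K) k) ≤ 1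
    rw [this]
    exact (Valuation.map_sub _ _ _).trans (max_le hc (hk.le.trans hd1))
  obtain ⟨b, hb⟩ := v.exists_valuation_sub_lt_of_integer hk1 (Units.mk0 _ hd0)
  obtain ⟨e, he, hew⟩ := exists_away v d hd
  obtain ⟨y, hy⟩ := v.exists_intValuation_mul_sub_lt (a := e) (b := b)
    (by rw [he]; exact v.intValuation_le_one b) (WithZero.unitsWithZeroEquiv (Units.mk0 _ hd0))
  rw [WithZero.unitsWithZeroEquiv_apply, WithZero.coe_unzero] at hy
  refine ⟨y * e, ?_, fun w hw => ?_⟩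
  · have h3 : c - algebraMap K (v.adicCompletion K) (algebraMap (𝓞 K) K (y * e)) =
        (c - algebraMap K (v.adicCompletion K) k) -
          algebraMap K (v.adicCompletion K) (algebraMap (𝓞 K) K b - k) +
          algebraMap K (v.adicCompletion K) (algebraMap (𝓞 K) K (b - y * e)) := by
      simp only [map_sub]; ring
    rw [h3]
    refine (Valuation.map_add _ _ _).trans (max_le ((Valuation.map_sub _ _ _).trans
      (max_le hk.le ?_)) ?_)
    · refine le_trans (le_of_eq ?_) hb.le
      exact v.valuedAdicCompletion_eq_valuation' _
    · rw [val_algebraMap]; exact hy.le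
  · rw [map_mul]
    exact (mul_le_of_le_one_left' (w.intValuation_le_one y)).trans (hew w hw)


theorem exists_denom (Y : Submodule (𝓞 K) V) (hY : Submodule.span K (Y : Set V) = ⊤) (x : V) :
    ∃ a : 𝓞 K, a ≠ 0 ∧ a • x ∈ Y := by
  have hx : x ∈ Submodule.span K (Y : Set V) := by rw [hY]; trivial
  induction hx using Submodule.span_induction with
  | mem x hx => exact ⟨1, one_ne_zero, by simpa using hx⟩
  | zero => exact ⟨1, one_ne_zero, by simp⟩
  | add x y _ _ hx hy =>
    obtain ⟨a, ha, hax⟩ := hx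
    obtain ⟨b, hb, hby⟩ := hy
    refine ⟨a * b, mul_ne_zero ha hb, ?_⟩
    rw [smul_add]
    refine Y.add_mem ?_ ?_
    · rw [mul_comm, mul_smul]; exact Y.smul_mem _ hax
    · rw [mul_smul]; exact Y.smul_mem _ hby
  | smul k x _ hx =>
    obtain ⟨a, ha, hax⟩ := hx
    obtain ⟨r, s, hs, rfl⟩ := IsFractionRing.div_surjective (A := 𝓞 K) k
    have hs0 : s ≠ 0 := nonZeroDivisors.ne_zero hs
    have hs1 : algebraMap (𝓞 K) K s ≠ 0 := by simpa using hs0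
    refine ⟨s * a, mul_ne_zero hs0 ha, ?_⟩
    have : (s * a) • (algebraMap (𝓞 K) K r / algebraMap (𝓞 K) K s) • x = r • a • x := by
      rw [← algebraMap_smul K (s * a), ← algebraMap_smul K r, ← algebraMap_smul K a,
        smul_smul, smul_smul, map_mul]
      congr 1
      field_simp
    rw [this]
    exact Y.smul_mem _ hax

theorem smul_cancel (a : 𝓞 K) (ha : a ≠ 0) {x y : V} (h : a • x = a • y) : x = y := by
  have ha1 : algebraMap (𝓞 K) K a ≠ 0 := by simpa using ha
  rw [← algebraMap_smul K a x, ← algebraMap_smul K a y] at h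
  exact smul_right_injective V ha1 h

theorem isLocalizedModule_lat (Y : Submodule (𝓞 K) V)
    (hY : Submodule.span K (Y : Set V) = ⊤) : IsLocalizedModule (𝓞 K)⁰ Y.subtype where
  map_units s := by
    have hs1 : algebraMap (𝓞 K) K s ≠ 0 := by simp
    rw [Module.End.isUnit_iff]
    constructor
    · intro x y h
      exact smul_cancel _ (nonZeroDivisors.ne_zero s.2) h
    · intro y
      refine ⟨(algebraMap (𝓞 K) K s)⁻¹ • y, ?_⟩
      rw [Module.algebraMap_end_apply, ← IsScalarTower.algebraMap_smul K, smul_smul,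
        mul_inv_cancel₀ hs1, one_smul]
  surj y := by
    obtain ⟨a, ha, hay⟩ := exists_denom Y hY y
    exact ⟨(⟨_, hay⟩, ⟨a, mem_nonZeroDivisors_of_ne_zero ha⟩), rfl⟩
  exists_of_eq {x y} h := ⟨1, by simpa using h⟩

/-- Dual basis data of a lattice. -/
theorem exists_dual (Y : Submodule (𝓞 K) V) (hY : IsZLat Y) :
    ∃ (n : ℕ) (y : Fin n → V) (F : Fin n → V →ₗ[K] K), (∀ i, y i ∈ Y) ∧
      (∀ i, ∀ x ∈ Y, ∃ r : 𝓞 K, F i x = algebraMap (𝓞 K) K r) ∧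
      ∀ x, x = ∑ i, F i x • y i := by
  have : Module.Finite (𝓞 K) Y := Module.Finite.iff_fg.mpr hY.1
  have : Module.IsTorsionFree (𝓞 K) V := Module.IsTorsionFree.trans_faithfulSMul (𝓞 K) K V
  have : Module.FinitePresentation (𝓞 K) Y := Module.finitePresentation_of_finite _ _
  have : Module.Projective (𝓞 K) Y := Module.Flat.projective_of_finitePresentation
  obtain ⟨n, p, hp⟩ := Module.Finite.exists_fin' (𝓞 K) Y
  obtain ⟨s, hs⟩ := p.exists_rightInverse_of_surjective (LinearMap.range_eq_top.mpr hp)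
  have := isLocalizedModule_lat Y hY.2
  have hu : ∀ x : (𝓞 K)⁰, IsUnit (algebraMap (𝓞 K) (Module.End (𝓞 K) K) x) := by
    intro x
    exact IsLocalizedModule.map_units (S := (𝓞 K)⁰) (Algebra.linearMap (𝓞 K) K) x
  let G : Fin n → V →ₗ[𝓞 K] K := fun i => IsLocalizedModule.lift (𝓞 K)⁰ Y.subtype
    (Algebra.linearMap (𝓞 K) K ∘ₗ LinearMap.proj i ∘ₗ s) hu
  have hG : ∀ i (x : Y), G i x = algebraMap (𝓞 K) K (s x i) := by
    intro i x
    exact IsLocalizedModule.lift_apply (𝓞 K)⁰ Y.subtype _ hu x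
  refine ⟨n, fun i => p (Pi.single i 1), fun i => (G i).extendScalarsOfIsLocalization (𝓞 K)⁰ K,
    fun i => (p _).2, fun i x hx => ⟨s ⟨x, hx⟩ i, ?_⟩, fun x => ?_⟩
  · exact hG i ⟨x, hx⟩
  · obtain ⟨a, ha, hax⟩ := exists_denom Y hY.2 x
    apply smul_cancel a ha
    have h1 : (⟨a • x, hax⟩ : Y) = p (s ⟨a • x, hax⟩) := by
      rw [← LinearMap.comp_apply, hs]; rfl
    have h2 : p (s ⟨a • x, hax⟩) = ∑ i, s ⟨a • x, hax⟩ i • p (Pi.single i 1) := by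
      conv_lhs => rw [pi_eq_sum_univ' (s ⟨a • x, hax⟩)]
      rw [map_sum]
      simp only [map_smul]
    have h3 := congrArg (Subtype.val) (h1.trans h2)
    simp only [Submodule.coe_sum, Submodule.coe_smul] at h3
    rw [h3, Finset.smul_sum]
    refine Finset.sum_congr rfl fun i _ => ?_
    have h4 : algebraMap (𝓞 K) K (s ⟨a • x, hax⟩ i) = a • G i x := by
      rw [← hG, ← map_smul]
    rw [← IsScalarTower.algebraMap_smul K, h4, smul_assoc]
    rfl

end helpers

section local_part

/-- The image of a global integer in the completion. -/
noncomputable def ri (v : HeightOneSpectrum (𝓞 K)) (r : 𝓞 K) : v.adicCompletion K :=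
  algebraMap K (v.adicCompletion K) (algebraMap (𝓞 K) K r)

theorem ri_mul (v : HeightOneSpectrum (𝓞 K)) (r s : 𝓞 K) : ri v (r * s) = ri v r * ri v s := by
  simp [ri]

theorem ri_mem (v : HeightOneSpectrum (𝓞 K)) (r : 𝓞 K) :
    ri v r ∈ v.adicCompletionIntegers K := by
  rw [HeightOneSpectrum.mem_adicCompletionIntegers, ri, val_algebraMap]
  exact v.intValuation_le_one r

theorem ri_ne_zero (v : HeightOneSpectrum (𝓞 K)) (r : 𝓞 K) (hr : r ≠ 0) : ri v r ≠ 0 := by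
  simpa [ri] using hr

theorem ri_div_mem (v : HeightOneSpectrum (𝓞 K)) (r : 𝓞 K) (hr : r ≠ 0) (c : v.adicCompletion K)
    (h : Valued.v c ≤ v.intValuation r) : c / ri v r ∈ v.adicCompletionIntegers K := by
  rw [HeightOneSpectrum.mem_adicCompletionIntegers, map_div₀, ri, val_algebraMap]
  exact div_le_one_of_le₀ h zero_le

/-- The canonical map into the completion. -/
noncomputable def tens (v : HeightOneSpectrum (𝓞 K)) (x : V) : (v.adicCompletion K) ⊗[K] V :=
  (1 : v.adicCompletion K) ⊗ₜ[K] x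

theorem tens_add (v : HeightOneSpectrum (𝓞 K)) (x y : V) :
    tens (K := K) v (x + y) = tens v x + tens v y := TensorProduct.tmul_add _ _ _

theorem tens_smul (v : HeightOneSpectrum (𝓞 K)) (k : K) (x : V) :
    tens v (k • x) = algebraMap K (v.adicCompletion K) k • tens v x := by
  rw [tens, tens, TensorProduct.tmul_smul, TensorProduct.smul_tmul', TensorProduct.smul_tmul',
    Algebra.smul_def, smul_eq_mul]

theorem tens_smul' (v : HeightOneSpectrum (𝓞 K)) (r : 𝓞 K) (x : V) :
    tens v (r • x) = ri v r • tens (K := K) v x := by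
  rw [← algebraMap_smul K r x, tens_smul]; rfl

theorem tens_sum (v : HeightOneSpectrum (𝓞 K)) {n : ℕ} (f : Fin n → V) :
    tens (K := K) v (∑ i, f i) = ∑ i, tens v (f i) := TensorProduct.tmul_sum _ _ _

theorem tens_mem (v : HeightOneSpectrum (𝓞 K)) {N : Submodule (𝓞 K) V} {x : V} (hx : x ∈ N) :
    tens v x ∈ latCompletion v N := Submodule.subset_span ⟨x, hx, rfl⟩

theorem smul_mem_lat (v : HeightOneSpectrum (𝓞 K)) {N : Submodule (𝓞 K) V}
    {c : v.adicCompletion K} (hc : c ∈ v.adicCompletionIntegers K)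
    {z : (v.adicCompletion K) ⊗[K] V} (hz : z ∈ latCompletion v N) :
    c • z ∈ latCompletion v N :=
  (latCompletion v N).smul_mem (⟨c, hc⟩ : (v.adicCompletionIntegers K).toSubring) hz

/-- Induction principle for completions of lattices along linear maps. -/
theorem lat_le (v : HeightOneSpectrum (𝓞 K)) {N N' : Submodule (𝓞 K) V}
    (g : ((v.adicCompletion K) ⊗[K] V) →ₗ[v.adicCompletion K] ((v.adicCompletion K) ⊗[K] V))
    (h : ∀ x ∈ N, g (tens v x) ∈ latCompletion v N')
    {z : (v.adicCompletion K) ⊗[K] V} (hz : z ∈ latCompletion v N) :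
    g z ∈ latCompletion v N' := by
  rw [latCompletion] at hz
  induction hz using Submodule.span_induction with
  | mem z hz => obtain ⟨x, hx, rfl⟩ := hz; exact h x hx
  | zero => rw [map_zero]; exact Submodule.zero_mem _
  | add x y _ _ hx hy => rw [map_add]; exact Submodule.add_mem _ hx hy
  | smul a x _ hx =>
    have : g (a • x) = (a : v.adicCompletion K) • g x := by
      rw [← map_smul]; rfl
    rw [this]
    exact smul_mem_lat v a.2 hx

/-- Extension of a functional to the completion. -/
noncomputable def coord (v : HeightOneSpectrum (𝓞 K)) (F : V →ₗ[K] K) :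
    ((v.adicCompletion K) ⊗[K] V) →ₗ[v.adicCompletion K] v.adicCompletion K :=
  LinearMap.liftBaseChange _ (Algebra.linearMap K (v.adicCompletion K) ∘ₗ F)

theorem coord_tens (v : HeightOneSpectrum (𝓞 K)) (F : V →ₗ[K] K) (x : V) :
    coord v F (tens v x) = algebraMap K (v.adicCompletion K) (F x) := by
  simp [coord, tens]

theorem eq_sum_coord (v : HeightOneSpectrum (𝓞 K)) {n : ℕ} {y : Fin n → V}
    {F : Fin n → V →ₗ[K] K} (h : ∀ x, x = ∑ i, F i x • y i) (z : (v.adicCompletion K) ⊗[K] V) :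
    z = ∑ i, coord v (F i) z • tens v (y i) := by
  induction z using TensorProduct.induction_on with
  | zero => simp
  | add a b ha hb =>
    simp only [map_add, add_smul, Finset.sum_add_distrib]
    rw [← ha, ← hb]
  | tmul a x =>
    have h1 : a ⊗ₜ[K] x = a • tens v x := by
      rw [tens, TensorProduct.smul_tmul', smul_eq_mul, mul_one]
    rw [h1]
    simp only [map_smul, coord_tens, smul_assoc, ← tens_smul]
    rw [← Finset.smul_sum, ← tens_sum, ← h x]

theorem coord_mem (v : HeightOneSpectrum (𝓞 K)) {N : Submodule (𝓞 K) V} (F : V →ₗ[K] K)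
    (hF : ∀ x ∈ N, ∃ r : 𝓞 K, F x = algebraMap (𝓞 K) K r)
    {z : (v.adicCompletion K) ⊗[K] V} (hz : z ∈ latCompletion v N) :
    coord v F z ∈ v.adicCompletionIntegers K := by
  rw [latCompletion] at hz
  induction hz using Submodule.span_induction with
  | mem z hz =>
    obtain ⟨x, hx, rfl⟩ := hz
    obtain ⟨r, hr⟩ := hF x hx
    have := coord_tens v F x
    rw [hr] at this
    rw [tens] at this
    rw [this]
    exact ri_mem v r
  | zero => rw [map_zero]; exact zero_mem _
  | add x y _ _ hx hy => rw [map_add]; exact add_mem hx hy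
  | smul a x _ hx =>
    have : coord v F (a • x) = (a : v.adicCompletion K) * coord v F x := by
      rw [← smul_eq_mul, ← map_smul]; rfl
    rw [this]
    exact mul_mem a.2 hx

theorem mem_of_forall (Y : Submodule (𝓞 K) V) (hY : IsZLat Y) (x : V)
    (h : ∀ v : HeightOneSpectrum (𝓞 K), tens v x ∈ latCompletion v Y) : x ∈ Y := by
  obtain ⟨n, y, F, hy, hF, hx⟩ := exists_dual Y hY
  rw [hx x]
  refine Submodule.sum_mem _ fun i _ => ?_
  have : F i x ∈ (algebraMap (𝓞 K) K).range := by
    refine HeightOneSpectrum.mem_integers_of_valuation_le_one K _ fun v => ?_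
    have := coord_mem v (F i) (hF i) (h v)
    rw [coord_tens, HeightOneSpectrum.mem_adicCompletionIntegers] at this
    rw [← v.valuedAdicCompletion_eq_valuation']
    exact this
  obtain ⟨r, hr⟩ := this
  rw [← hr, algebraMap_smul]
  exact Y.smul_mem _ (hy i)

theorem exists_loc_denom (v : HeightOneSpectrum (𝓞 K)) (Y : Submodule (𝓞 K) V) (hY : IsZLat Y)
    (g : ((v.adicCompletion K) ⊗[K] V) →ₗ[v.adicCompletion K] ((v.adicCompletion K) ⊗[K] V)) :
    ∃ d : 𝓞 K, d ≠ 0 ∧ ∀ z ∈ latCompletion v Y, ri v d • g z ∈ latCompletion v Y := by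
  obtain ⟨n, y, F, hy, hF, hx⟩ := exists_dual Y hY
  have h1 : ∀ i j : Fin n, ∃ b : 𝓞 K, b ≠ 0 ∧
      coord v (F i) (g (tens v (y j))) * ri v b ∈ v.adicCompletionIntegers K := by
    intro i j
    obtain ⟨b, hb, h⟩ := HeightOneSpectrum.adicCompletion.mul_nonZeroDivisor_mem_adicCompletionIntegers v
      (coord v (F i) (g (tens v (y j))))
    exact ⟨b, nonZeroDivisors.ne_zero hb, h⟩
  choose b hb0 hb using h1
  refine ⟨∏ i, ∏ j, b i j, Finset.prod_ne_zero_iff.mpr fun i _ =>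
    Finset.prod_ne_zero_iff.mpr fun j _ => hb0 i j, fun z hz => ?_⟩
  have hd : ∀ i j, b i j ∣ ∏ i, ∏ j, b i j := fun i j =>
    (Finset.dvd_prod_of_mem (fun j => b i j) (Finset.mem_univ j)).trans
      (Finset.dvd_prod_of_mem (fun i => ∏ j, b i j) (Finset.mem_univ i))
  generalize (∏ i, ∏ j, b i j) = d at hd
  rw [eq_sum_coord v hx (ri v d • g z)]
  refine Submodule.sum_mem _ fun i _ => smul_mem_lat v ?_ (tens_mem v (hy i))
  rw [eq_sum_coord v hx z]
  simp only [map_smul, map_sum, smul_eq_mul, Finset.mul_sum]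
  refine sum_mem fun j _ => ?_
  obtain ⟨c, hc⟩ := hd i j
  have : ri v d * (coord v (F j) z * coord v (F i) (g (tens v (y j)))) =
      coord v (F j) z * (coord v (F i) (g (tens v (y j))) * ri v (b i j)) * ri v c := by
    rw [hc, ri_mul]; ring
  rw [this]
  exact mul_mem (mul_mem (coord_mem v (F j) (hF j) hz) (hb i j)) (ri_mem v c)

theorem exists_glob_denom (X Y : Submodule (𝓞 K) V) (hX : IsZLat X) (hY : IsZLat Y) :
    ∃ d : 𝓞 K, d ≠ 0 ∧ ∀ x ∈ X, d • x ∈ Y := by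
  obtain ⟨S, hS⟩ := hX.1
  choose a ha0 ha using exists_denom Y hY.2
  refine ⟨∏ s ∈ S, a s, Finset.prod_ne_zero_iff.mpr fun s _ => ha0 s, ?_⟩
  rw [← hS]
  intro x hx
  induction hx using Submodule.span_induction with
  | mem x hx =>
    obtain ⟨c, hc⟩ := Finset.dvd_prod_of_mem a hx
    rw [hc, mul_comm, mul_smul]
    exact Y.smul_mem _ (ha x)
  | zero => simp
  | add x y _ _ hx hy => rw [smul_add]; exact Y.add_mem hx hy
  | smul r x _ hx => rw [smul_comm]; exact Y.smul_mem _ hx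

theorem lat_mono_of_unit (v : HeightOneSpectrum (𝓞 K)) (X Y : Submodule (𝓞 K) V) (d : 𝓞 K)
    (hd : ∀ x ∈ X, d • x ∈ Y) (hv : v.intValuation d = 1) :
    latCompletion v X ≤ latCompletion v Y := by
  intro z hz
  refine lat_le v LinearMap.id (fun x hx => ?_) hz
  have hd0 : d ≠ 0 := by rintro rfl; simp at hv
  have h1 : tens v x = (1 / ri v d) • tens v (d • x) := by
    rw [tens_smul', smul_smul, one_div_mul_cancel (ri_ne_zero v d hd0), one_smul]
  rw [LinearMap.id_apply, h1]
  exact smul_mem_lat v (ri_div_mem v d hd0 _ (by simp [hv])) (tens_mem v (hd x hx))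

theorem finite_lt (d : 𝓞 K) (hd : d ≠ 0) :
    {v : HeightOneSpectrum (𝓞 K) | v.intValuation d ≠ 1}.Finite := by
  have : {v : HeightOneSpectrum (𝓞 K) | v.asIdeal ∣ Ideal.span {d}}.Finite :=
    Ideal.finite_factors (by simpa using hd)
  refine this.subset fun v hv => ?_
  exact (v.intValuation_lt_one_iff_dvd d).mp (lt_of_le_of_ne (v.intValuation_le_one d) hv)

theorem finite_ne (X Y : Submodule (𝓞 K) V) (hX : IsZLat X) (hY : IsZLat Y) :
    {v : HeightOneSpectrum (𝓞 K) | latCompletion v X ≠ latCompletion v Y}.Finite := by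
  obtain ⟨d, hd0, hd⟩ := exists_glob_denom X Y hX hY
  obtain ⟨e, he0, he⟩ := exists_glob_denom Y X hY hX
  refine ((finite_lt d hd0).union (finite_lt e he0)).subset fun v hv => ?_
  by_contra h
  simp only [Set.mem_union, Set.mem_ofPred_eq, not_or, not_not] at h
  exact hv (le_antisymm (lat_mono_of_unit v X Y d hd h.1) (lat_mono_of_unit v Y X e he h.2))

theorem exists_glue (L : Submodule (𝓞 K) V) (hL : IsZLat L)
    (g : ∀ v : HeightOneSpectrum (𝓞 K), ((v.adicCompletion K) ⊗[K] V) ≃ₗ[v.adicCompletion K]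
        ((v.adicCompletion K) ⊗[K] V)) (S : Set (HeightOneSpectrum (𝓞 K))) (hS : S.Finite)
    (hg : ∀ v, v ∉ S → g v = LinearEquiv.refl _ _) :
    ∃ X : Submodule (𝓞 K) V, IsZLat X ∧
      ∀ v, ⇑(g v) '' (latCompletion v L : Set _) = (latCompletion v X : Set _) := by
  have h1 : ∀ v, ∃ d : 𝓞 K, d ≠ 0 ∧ ∀ z ∈ latCompletion v L, ri v d • g v z ∈ latCompletion v L :=
    fun v => exists_loc_denom v L hL (g v).toLinearMap
  have h2 : ∀ v, ∃ d : 𝓞 K, d ≠ 0 ∧ ∀ z ∈ latCompletion v L,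
      ri v d • (g v).symm z ∈ latCompletion v L :=
    fun v => exists_loc_denom v L hL (g v).symm.toLinearMap
  choose p hp0 hp using h1
  choose q hq0 hq using h2
  obtain ⟨d, hd0, hd1, hd2⟩ : ∃ d : 𝓞 K, d ≠ 0 ∧
      (∀ v, ∀ z ∈ latCompletion v L, ri v d • g v z ∈ latCompletion v L) ∧
      (∀ v, ∀ z ∈ latCompletion v L, ri v d • (g v).symm z ∈ latCompletion v L) := by
    refine ⟨∏ v ∈ hS.toFinset, p v * q v, Finset.prod_ne_zero_iff.mpr fun v _ =>
      mul_ne_zero (hp0 v) (hq0 v), fun v z hz => ?_, fun v z hz => ?_⟩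
    · by_cases hv : v ∈ S
      · obtain ⟨c, hc⟩ := Finset.dvd_prod_of_mem (fun v => p v * q v) (hS.mem_toFinset.mpr hv)
        have : ri v (∏ v ∈ hS.toFinset, p v * q v) • g v z = ri v (q v * c) • (ri v (p v) • g v z) := by
          rw [hc, smul_smul, ← ri_mul]; congr 2; ring
        rw [this]
        exact smul_mem_lat v (ri_mem v _) (hp v z hz)
      · rw [hg v hv]
        exact smul_mem_lat v (ri_mem v _) hz
    · by_cases hv : v ∈ S
      · obtain ⟨c, hc⟩ := Finset.dvd_prod_of_mem (fun v => p v * q v) (hS.mem_toFinset.mpr hv)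
        have : ri v (∏ v ∈ hS.toFinset, p v * q v) • (g v).symm z =
            ri v (p v * c) • (ri v (q v) • (g v).symm z) := by
          rw [hc, smul_smul, ← ri_mul]; congr 2; ring
        rw [this]
        exact smul_mem_lat v (ri_mem v _) (hq v z hz)
      · rw [hg v hv]
        exact smul_mem_lat v (ri_mem v _) hz
  let X : Submodule (𝓞 K) V :=
    { carrier := {x | ∀ v, (g v).symm (tens v x) ∈ latCompletion v L}
      zero_mem' := fun v => by
        have : tens (K := K) v (0 : V) = 0 := TensorProduct.tmul_zero _ _
        rw [this, map_zero]; exact Submodule.zero_mem _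
      add_mem' := fun {a b} ha hb v => by
        rw [tens_add, map_add]; exact Submodule.add_mem _ (ha v) (hb v)
      smul_mem' := fun r a ha v => by
        rw [tens_smul', map_smul]; exact smul_mem_lat v (ri_mem v r) (ha v) }
  have hLX : ∀ x ∈ L, d • x ∈ X := fun x hx v => by
    rw [tens_smul', map_smul]
    exact hd2 v _ (tens_mem v hx)
  have hXL : ∀ x ∈ X, d • x ∈ L := fun x hx => by
    refine mem_of_forall L hL _ fun v => ?_
    have := hd1 v _ (hx v)
    rwa [LinearEquiv.apply_symm_apply, ← tens_smul'] at this
  have hdK : algebraMap (𝓞 K) K d ≠ 0 := by simpa using hd0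
  refine ⟨X, ⟨?_, ?_⟩, fun v => ?_⟩
  · have hinj : Function.Injective (LinearMap.lsmul (𝓞 K) V d) := fun x y h => smul_cancel d hd0 h
    have : IsNoetherian (𝓞 K) L := isNoetherian_of_fg_of_noetherian L hL.1
    apply Submodule.fg_of_fg_map_injective _ hinj
    have hle : X.map (LinearMap.lsmul (𝓞 K) V d) ≤ L := by
      rintro _ ⟨x, hx, rfl⟩; exact hXL x hx
    have h3 := IsNoetherian.noetherian ((X.map (LinearMap.lsmul (𝓞 K) V d)).comap L.subtype)
    have h4 := h3.map L.subtype
    rwa [Submodule.map_comap_subtype, inf_eq_right.mpr hle] at h4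
  · rw [eq_top_iff, ← hL.2, Submodule.span_le]
    intro x hx
    have : x = (algebraMap (𝓞 K) K d)⁻¹ • (d • x) := by
      rw [← algebraMap_smul K d x, smul_smul, inv_mul_cancel₀ hdK, one_smul]
    rw [this]
    exact Submodule.smul_mem _ _ (Submodule.subset_span (hLX x hx))
  · apply Set.Subset.antisymm
    · rintro _ ⟨z, hz, rfl⟩
      obtain ⟨n, l, F, hl, hF, hx⟩ := exists_dual L hL
      have hdv := ri_ne_zero v d hd0
      have hy := hd1 v z hz
      have hc := fun i => coord_mem v (F i) (hF i) hy
      have hsum := eq_sum_coord v hx (ri v d • g v z)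
      generalize hcc : (fun i => coord v (F i) (ri v d • g v z)) = c
      have hcc' := fun i => congrFun hcc i
      simp only [hcc'] at hc hsum
      choose a ha haw using fun i => exists_approx v (d * d) (mul_ne_zero hd0 hd0) (c i) (hc i)
      have he := fun i => ri_div_mem v (d * d) (mul_ne_zero hd0 hd0) _ (ha i)
      generalize hee : (fun i => (c i - algebraMap K (v.adicCompletion K)
        (algebraMap (𝓞 K) K (a i))) / ri v (d * d)) = e
      have hee' := fun i => congrFun hee i
      simp only [hee'] at he
      have hca : ∀ i, c i = ri v (a i) + ri v d * ri v d * e i := by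
        intro i
        rw [← hee' i, ← ri_mul, mul_div_cancel₀ _ (ri_ne_zero v _ (mul_ne_zero hd0 hd0)), ri]
        ring
      set x : V := ∑ i, ((algebraMap (𝓞 K) K d)⁻¹ * algebraMap (𝓞 K) K (a i)) • l i with hxdef
      have htx : ∀ w, tens w x = ∑ i, ((ri w d)⁻¹ * ri w (a i)) • tens w (l i) := by
        intro w
        rw [hxdef, tens_sum]
        refine Finset.sum_congr rfl fun i _ => ?_
        rw [tens_smul, map_mul, map_inv₀]; rfl
      have hgz : g v z = tens v x + ∑ i, e i • tens v (d • l i) := by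
        have : g v z = (ri v d)⁻¹ • (ri v d • g v z) := by
          rw [smul_smul, inv_mul_cancel₀ hdv, one_smul]
        rw [this, hsum, htx, Finset.smul_sum, ← Finset.sum_add_distrib]
        refine Finset.sum_congr rfl fun i _ => ?_
        rw [tens_smul', smul_smul, smul_smul, ← add_smul, hca]
        congr 1
        field_simp
      have hxX : x ∈ X := by
        intro w
        by_cases hw : w = v
        · subst hw
          have : tens w x = g w z - ∑ i, e i • tens w (d • l i) := by rw [hgz]; simp
          rw [this, map_sub, LinearEquiv.symm_apply_apply, map_sum]
          refine Submodule.sub_mem _ hz (Submodule.sum_mem _ fun i _ => ?_)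
          rw [map_smul]
          exact smul_mem_lat w (he i) (hLX _ (hl i) w)
        · rw [htx, map_sum]
          refine Submodule.sum_mem _ fun i _ => ?_
          have h5 := ri_div_mem w (d * d) (mul_ne_zero hd0 hd0) (ri w (a i))
            (by rw [ri, val_algebraMap]; exact haw i w hw)
          have hdw := ri_ne_zero w d hd0
          have h6 : (ri w d)⁻¹ * ri w (a i) = (ri w (a i) / ri w (d * d)) * ri w d := by
            rw [ri_mul]; field_simp
          rw [h6, mul_smul, ← tens_smul', map_smul]
          exact smul_mem_lat w h5 (hLX _ (hl i) w)
      change g v z ∈ latCompletion v X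
      rw [hgz]
      exact Submodule.add_mem _ (tens_mem v hxX) (Submodule.sum_mem _ fun i _ =>
        smul_mem_lat v (he i) (tens_mem v (hLX _ (hl i))))
    · intro z hz
      refine ⟨(g v).symm z, ?_, LinearEquiv.apply_symm_apply _ _⟩
      exact lat_le v (N := X) (N' := L) (g v).symm.toLinearMap (fun x hx => hx v) hz

end local_part

section final_part

theorem IsIsom.refl' (Φ : LinearMap.BilinForm K V) {ι : Type*} (L : ι → Submodule (𝓞 K) V) :
    IsIsom Φ L L := ⟨LinearEquiv.refl K V, fun _ _ => rfl, fun i => Set.image_id _⟩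

theorem IsIsom.symm' {Φ : LinearMap.BilinForm K V} {ι : Type*} {L M : ι → Submodule (𝓞 K) V}
    (h : IsIsom Φ L M) : IsIsom Φ M L := by
  obtain ⟨g, hg, hL⟩ := h
  refine ⟨g.symm, fun x y => ?_, fun i => ?_⟩
  · rw [← hg, g.apply_symm_apply, g.apply_symm_apply]
  · rw [← hL i, Set.image_image]; simp

theorem IsIsom.trans' {Φ : LinearMap.BilinForm K V} {ι : Type*}
    {L M N : ι → Submodule (𝓞 K) V}
    (h : IsIsom Φ L M) (h' : IsIsom Φ M N) : IsIsom Φ L N := by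
  obtain ⟨g, hg, hL⟩ := h
  obtain ⟨g', hg', hL'⟩ := h'
  refine ⟨g.trans g', fun x y => ?_, fun i => ?_⟩
  · simp [hg', hg]
  · rw [← hL' i, ← hL i, Set.image_image]; rfl

theorem isom_of_quot_eq {Φ : LinearMap.BilinForm K V} {ι : Type*} {L : ι → Submodule (𝓞 K) V}
    {X Y : genusSet Φ L}
    (h : Quot.mk (fun X Y : genusSet Φ L => IsIsom Φ X.1 Y.1) X = Quot.mk _ Y) :
    IsIsom Φ X.1 Y.1 := by
  have := Quot.eqvGen_exact h
  clear h
  induction this with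
  | rel _ _ h => exact h
  | refl _ => exact IsIsom.refl' Φ _
  | symm _ _ _ ih => exact ih.symm'
  | trans _ _ _ _ _ ih ih' => exact ih.trans' ih'

theorem finite_between (X : Submodule (𝓞 K) V) (hX : X.FG) (n : 𝓞 K) (hn : n ≠ 0) :
    {Y : Submodule (𝓞 K) V | (∀ x ∈ X, n • x ∈ Y) ∧ ∀ y ∈ Y, n • y ∈ X}.Finite := by
  have : Module.Finite (𝓞 K) X := Module.Finite.iff_fg.mpr hX
  let I : Ideal (𝓞 K) := Ideal.span {n * n}
  have hI : I ≠ ⊥ := by simpa [I] using hn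
  have : Finite (𝓞 K ⧸ I) := Ideal.finiteQuotientOfFreeOfNeBot I hI
  let Q := X ⧸ (I • (⊤ : Submodule (𝓞 K) X))
  have : Finite Q := Module.finite_of_finite (𝓞 K ⧸ I)
  have : Finite (Submodule (𝓞 K) Q) := Finite.of_injective _ SetLike.coe_injective
  let m := LinearMap.lsmul (𝓞 K) V n
  let f : Submodule (𝓞 K) V → Submodule (𝓞 K) Q := fun Y =>
    ((Y.map m).comap X.subtype).map (Submodule.mkQ _)
  refine Set.Finite.of_injOn (f := f) (t := Set.univ) (fun _ _ => Set.mem_univ _) ?_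
    Set.finite_univ
  have key : ∀ Y : Submodule (𝓞 K) V, ((∀ x ∈ X, n • x ∈ Y) ∧ ∀ y ∈ Y, n • y ∈ X) →
      (((f Y).comap (Submodule.mkQ _)).map X.subtype).comap m = Y := by
    rintro Y ⟨h1, h2⟩
    have h3 : (f Y).comap (Submodule.mkQ _) = (Y.map m).comap X.subtype := by
      simp only [f]
      rw [Submodule.comap_map_mkQ, sup_eq_right]
      refine Submodule.smul_le.mpr fun r hr x _ => ?_
      obtain ⟨c, rfl⟩ := Ideal.mem_span_singleton'.mp hr
      refine ⟨c • n • x.1, Y.smul_mem _ (h1 _ x.2), ?_⟩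
      simp only [m, LinearMap.lsmul_apply, Submodule.subtype_apply, Submodule.coe_smul, smul_smul]
      congr 1; ring
    rw [h3, Submodule.map_comap_subtype, inf_eq_right.mpr, Submodule.comap_map_eq_of_injective]
    · exact fun x y h => smul_cancel n hn h
    · rintro _ ⟨y, hy, rfl⟩; exact h2 y hy
  intro Y hY Z hZ h
  rw [← key Y hY, ← key Z hZ, h]

theorem sameGenus_transfer {Φ : LinearMap.BilinForm K V} {ι : Type*}
    {L X : ι → Submodule (𝓞 K) V} (hX : X ∈ genusSet Φ L) (i j : ι) (n : 𝓞 K)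
    (h : ∀ x ∈ L i, n • x ∈ L j) : ∀ x ∈ X i, n • x ∈ X j := by
  intro x hx
  refine mem_of_forall _ (hX.1 j) _ fun v => ?_
  obtain ⟨g, -, hg⟩ := hX.2 v
  have h1 : tens v x ∈ (latCompletion v (X i) : Set _) := tens_mem v hx
  rw [← hg i] at h1
  obtain ⟨z, hz, hzx⟩ := h1
  rw [tens_smul', ← hzx, ← map_smul]
  change g (ri v n • z) ∈ (latCompletion v (X j) : Set _)
  rw [← hg j]
  refine Set.mem_image_of_mem _ ?_
  have := lat_le v (N := L i) (N' := L j) (ri v n • LinearMap.id) (fun y hy => by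
    rw [LinearMap.smul_apply, LinearMap.id_apply, ← tens_smul']
    exact tens_mem v (h y hy)) hz
  exact this

end final_part

theorem classNumber_subtuple_le
    [FiniteDimensional K V]
    (Φ : LinearMap.BilinForm K V)
    (hsymm : ∀ x y : V, Φ x y = Φ y x)
    (hnd : ∀ x : V, (∀ y : V, Φ x y = 0) → x = 0)
    (m : ℕ) (L : Fin m → Submodule (𝓞 K) V)
    (hlat : ∀ i, IsZLat (L i))
    (T : Finset (Fin m)) (hT : T.Nonempty) :
    classNumber Φ (fun i : {i : Fin m // i ∈ T} => L i.1) ≤ classNumber Φ L := by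
  set L' : {i : Fin m // i ∈ T} → Submodule (𝓞 K) V := fun i => L i.1 with hL'
  let res : genusSet Φ L → genusSet Φ L' := fun X =>
    ⟨fun i => X.1 i.1, fun i => X.2.1 i.1, fun v => by
      obtain ⟨g, hg, hgL⟩ := X.2.2 v
      exact ⟨g, hg, fun i => hgL i.1⟩⟩
  let φ : Quot (fun X Y : genusSet Φ L => IsIsom Φ X.1 Y.1) →
      Quot (fun X Y : genusSet Φ L' => IsIsom Φ X.1 Y.1) :=
    Quot.map res (fun X Y h => by
      obtain ⟨g, hg, hgL⟩ := h
      exact ⟨g, hg, fun i => hgL i.1⟩)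
  have hsurj : Function.Surjective φ := by
    intro q
    obtain ⟨X', rfl⟩ := Quot.exists_rep q
    let S : Set (HeightOneSpectrum (𝓞 K)) :=
      ⋃ i : {i : Fin m // i ∈ T}, {v | latCompletion v (L' i) ≠ latCompletion v (X'.1 i)}
    have hS : S.Finite := Set.finite_iUnion fun i => finite_ne _ _ (hlat i.1) (X'.2.1 i)
    have hex : ∀ v : HeightOneSpectrum (𝓞 K),
        ∃ g : ((v.adicCompletion K) ⊗[K] V) ≃ₗ[v.adicCompletion K] ((v.adicCompletion K) ⊗[K] V),
        ((∀ x y, Φ.baseChange (v.adicCompletion K) (g x) (g y) =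
          Φ.baseChange (v.adicCompletion K) x y) ∧
        ∀ i, ⇑g '' ((latCompletion v (L' i) : Set _)) = (latCompletion v (X'.1 i) : Set _)) ∧
        (v ∉ S → g = LinearEquiv.refl _ _) := by
      intro v
      by_cases hv : v ∈ S
      · obtain ⟨g, hg⟩ := X'.2.2 v
        exact ⟨g, hg, fun h => absurd hv h⟩
      · refine ⟨LinearEquiv.refl _ _, ⟨fun _ _ => rfl, fun i => ?_⟩, fun _ => rfl⟩
        have : latCompletion v (L' i) = latCompletion v (X'.1 i) := by
          by_contra hne
          exact hv (Set.mem_iUnion.mpr ⟨i, hne⟩)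
        rw [this]; exact Set.image_id _
    choose g hg hgS using hex
    choose X hX hXg using fun j => exists_glue (L j) (hlat j) g S hS hgS
    refine ⟨Quot.mk _ ⟨X, hX, fun v => ⟨g v, (hg v).1, fun j => hXg j v⟩⟩, ?_⟩
    have heq : res ⟨X, hX, fun v => ⟨g v, (hg v).1, fun j => hXg j v⟩⟩ = X' := by
      apply Subtype.ext
      funext i
      have hv : ∀ v, latCompletion v (X i.1) = latCompletion v (X'.1 i) := fun v =>
        SetLike.coe_injective ((hXg i.1 v).symm.trans ((hg v).2 i))
      apply le_antisymm
      · intro x hx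
        refine mem_of_forall _ (X'.2.1 i) x fun v => ?_
        rw [← hv v]; exact tens_mem v hx
      · intro x hx
        refine mem_of_forall _ (hX i.1) x fun v => ?_
        rw [hv v]; exact tens_mem v hx
    exact congrArg (Quot.mk _) heq
  have hfin : Finite (Quot (fun X Y : genusSet Φ L' => IsIsom Φ X.1 Y.1)) →
      Finite (Quot (fun X Y : genusSet Φ L => IsIsom Φ X.1 Y.1)) := by
    intro hQ'
    obtain ⟨t, ht⟩ := hT
    obtain ⟨n, hn0, hn1, hn2⟩ : ∃ n : 𝓞 K, n ≠ 0 ∧ (∀ j, ∀ x ∈ L t, n • x ∈ L j) ∧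
        ∀ j, ∀ x ∈ L j, n • x ∈ L t := by
      choose a ha0 ha using fun j => exists_glob_denom (L t) (L j) (hlat t) (hlat j)
      choose b hb0 hb using fun j => exists_glob_denom (L j) (L t) (hlat j) (hlat t)
      refine ⟨∏ j, a j * b j, Finset.prod_ne_zero_iff.mpr fun j _ =>
        mul_ne_zero (ha0 j) (hb0 j), fun j x hx => ?_, fun j x hx => ?_⟩
      · obtain ⟨c, hc⟩ := Finset.dvd_prod_of_mem (fun j => a j * b j) (Finset.mem_univ j)
        rw [hc, show a j * b j * c = (b j * c) * a j by ring, mul_smul]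
        exact Submodule.smul_mem _ _ (ha j x hx)
      · obtain ⟨c, hc⟩ := Finset.dvd_prod_of_mem (fun j => a j * b j) (Finset.mem_univ j)
        rw [hc, show a j * b j * c = (a j * c) * b j by ring, mul_smul]
        exact Submodule.smul_mem _ _ (hb j x hx)
    let B : Quot (fun X Y : genusSet Φ L' => IsIsom Φ X.1 Y.1) →
        Set (Fin m → Submodule (𝓞 K) V) := fun q' =>
      Set.pi Set.univ fun _ => {Y | (∀ x ∈ q'.out.1 ⟨t, ht⟩, n • x ∈ Y) ∧
        ∀ y ∈ Y, n • y ∈ q'.out.1 ⟨t, ht⟩}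
    have hB : (⋃ q', B q').Finite := Set.finite_iUnion fun q' =>
      Set.Finite.pi fun _ => finite_between _ (q'.out.2.1 ⟨t, ht⟩).1 n hn0
    have hex : ∀ q : Quot (fun X Y : genusSet Φ L => IsIsom Φ X.1 Y.1),
        ∃ Y : Fin m → Submodule (𝓞 K) V, Y ∈ (⋃ q', B q') ∧ IsIsom Φ q.out.1 Y := by
      intro q
      have h1 : φ q = Quot.mk _ (res q.out) := by
        conv_lhs => rw [← Quot.out_eq q]
        rfl
      have h2 : IsIsom Φ (res q.out).1 (φ q).out.1 :=
        isom_of_quot_eq (h1.symm.trans (Quot.out_eq _).symm)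
      obtain ⟨g, hg, hgT⟩ := h2
      have hgt : ∀ x, x ∈ q.out.1 t ↔ g x ∈ (φ q).out.1 ⟨t, ht⟩ := by
        intro x
        have h3 := hgT ⟨t, ht⟩
        constructor
        · intro hx
          have : g x ∈ ((φ q).out.1 ⟨t, ht⟩ : Set V) := by
            rw [← h3]; exact Set.mem_image_of_mem _ hx
          exact this
        · intro hx
          have hx' : g x ∈ ((φ q).out.1 ⟨t, ht⟩ : Set V) := hx
          rw [← h3] at hx'
          obtain ⟨y, hy, hyx⟩ := hx'
          rw [← g.injective hyx]; exact hy
      let gO : V →ₗ[𝓞 K] V := g.toLinearMap.restrictScalars (𝓞 K)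
      refine ⟨fun j => (q.out.1 j).map gO, Set.mem_iUnion.mpr ⟨φ q, fun j _ => ⟨?_, ?_⟩⟩,
        g, hg, fun j => rfl⟩
      · intro x hx
        refine ⟨n • g.symm x, sameGenus_transfer q.out.2 t j n (hn1 j) _ ?_, ?_⟩
        · rw [hgt, g.apply_symm_apply]; exact hx
        · rw [map_smul]; congr 1; exact g.apply_symm_apply x
      · rintro _ ⟨x, hx, rfl⟩
        rw [← map_smul]
        exact (hgt _).mp (sameGenus_transfer q.out.2 j t n (hn2 j) _ hx)
    choose ψ hψ1 hψ2 using hex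
    have := hB.to_subtype
    refine Finite.of_injective (fun q => (⟨ψ q, hψ1 q⟩ : ↥(⋃ q', B q'))) ?_
    intro q r h
    have h' : ψ q = ψ r := congrArg Subtype.val h
    rw [← Quot.out_eq q, ← Quot.out_eq r]
    apply Quot.sound
    have h4 := hψ2 q
    rw [h'] at h4
    exact h4.trans' (hψ2 r).symm'
  unfold _root_.classNumber
  by_cases hQ : Finite (Quot (fun X Y : genusSet Φ L => IsIsom Φ X.1 Y.1))
  · exact Nat.card_le_card_of_surjective φ hsurj
  · have hQ' : Infinite (Quot (fun X Y : genusSet Φ L' => IsIsom Φ X.1 Y.1)) := by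
      rw [← not_finite_iff_infinite]
      exact fun h => hQ (hfin h)
    rw [Nat.card_eq_zero_of_infinite]
    exact Nat.zero_le _
end

section
/- Let L be a Z_K-lattice in V and let p be a maximal ideal of Z_K. Then the class number of ρ_p(L) is at most the class number of L, i.e. h(ρ_p(L)) ≤ h(L). -/
/-
STATEMENT 11: Let L be a Z_K-lattice in V and let p be a maximal ideal of Z_K.
Then the class number of ρ_p(L) is at most the class number of L, i.e.
h(ρ_p(L)) ≤ h(L).
-/

set_option maxHeartbeats 1000000
set_option synthInstance.maxHeartbeats 1000000

open NumberField IsDedekindDomain TensorProduct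
open scoped nonZeroDivisors

variable {K : Type*} [Field K] [NumberField K]
variable {V : Type*} [AddCommGroup V] [Module K V]
  [Module (𝓞 K) V] [IsScalarTower (𝓞 K) K V]

/-- The dual lattice `L^# = {x ∈ V : Φ(x, L) ⊆ Z_K}`. -/
def dualLatK (Φ : LinearMap.BilinForm K V) (L : Submodule (𝓞 K) V) :
    Submodule (𝓞 K) V where
  carrier := {x | ∀ y ∈ L, Φ x y ∈ (algebraMap (𝓞 K) K).range}
  add_mem' := by
    intro x x' hx hx' y hy
    rw [map_add, LinearMap.add_apply]
    exact add_mem (hx y hy) (hx' y hy)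
  zero_mem' := by
    intro y hy
    rw [map_zero, LinearMap.zero_apply]
    exact zero_mem _
  smul_mem' := by
    intro c x hx y hy
    have h1 : (c • x : V) = (algebraMap (𝓞 K) K c) • x := (algebraMap_smul K c x).symm
    rw [h1, map_smul, LinearMap.smul_apply, smul_eq_mul]
    exact mul_mem ⟨c, rfl⟩ (hx y hy)

/-- The product `I·N` of a fractional ideal `I` of `K` (given as a
`Z_K`-submodule of `K`) with a lattice `N`, taken inside `V`. -/
def smulLatK (I : Submodule (𝓞 K) K) (N : Submodule (𝓞 K) V) : Submodule (𝓞 K) V :=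
  Submodule.span (𝓞 K) (Set.image2 (fun (a : K) (v : V) => a • v) (I : Set K) (N : Set V))

/-- The operator `ρ_p(L) = L + (p⁻¹L ∩ p·L^#)`. -/
noncomputable def rhoK (Φ : LinearMap.BilinForm K V) (p : Ideal (𝓞 K))
    (L : Submodule (𝓞 K) V) : Submodule (𝓞 K) V :=
  L ⊔ (smulLatK ((((p : FractionalIdeal (𝓞 K)⁰ K))⁻¹ : FractionalIdeal (𝓞 K)⁰ K) :
        Submodule (𝓞 K) K) L ⊓
      smulLatK (((p : FractionalIdeal (𝓞 K)⁰ K)) : Submodule (𝓞 K) K) (dualLatK Φ L))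

section helpers

set_option linter.unusedSectionVars false

lemma hv_one_tmul_smul (v : HeightOneSpectrum (𝓞 K)) (k : K) (x : V) :
    (algebraMap K (v.adicCompletion K) k) • ((1 : v.adicCompletion K) ⊗ₜ[K] x) =
      (1 : v.adicCompletion K) ⊗ₜ[K] (k • x) := by
  rw [TensorProduct.smul_tmul', smul_eq_mul, mul_one, TensorProduct.tmul_smul,
    TensorProduct.smul_tmul', Algebra.smul_def, mul_one]

lemma hv_val (v : HeightOneSpectrum (𝓞 K)) (k : K) :
    Valued.v (algebraMap K (v.adicCompletion K) k) = v.valuation K k :=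
  v.valuedAdicCompletion_eq_valuation' k

lemma hv_val_le (v : HeightOneSpectrum (𝓞 K)) (r : 𝓞 K) :
    Valued.v (algebraMap K (v.adicCompletion K) (algebraMap (𝓞 K) K r)) ≤ 1 := by
  rw [hv_val]; exact v.valuation_le_one r

lemma hv_val_ne (v : HeightOneSpectrum (𝓞 K)) {r : 𝓞 K} (hr : r ≠ 0) :
    algebraMap K (v.adicCompletion K) (algebraMap (𝓞 K) K r) ≠ 0 := by
  simpa using hr

lemma latC_smul (v : HeightOneSpectrum (𝓞 K)) (N : Submodule (𝓞 K) V)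
    {c : v.adicCompletion K} (hc : Valued.v c ≤ 1) {w : (v.adicCompletion K) ⊗[K] V}
    (hw : w ∈ latCompletion v N) : c • w ∈ latCompletion v N :=
  (latCompletion v N).smul_mem (⟨c, hc⟩ : (v.adicCompletionIntegers K).toSubring) hw

lemma latC_of_mem (v : HeightOneSpectrum (𝓞 K)) {N : Submodule (𝓞 K) V} {x : V} (hx : x ∈ N) :
    (1 : v.adicCompletion K) ⊗ₜ[K] x ∈ latCompletion v N :=
  Submodule.subset_span ⟨x, hx, rfl⟩

lemma latC_induction (v : HeightOneSpectrum (𝓞 K)) (N : Submodule (𝓞 K) V)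
    {P : (v.adicCompletion K) ⊗[K] V → Prop} (h0 : P 0)
    (hadd : ∀ x y, P x → P y → P (x + y))
    (hsmul : ∀ (c : v.adicCompletion K) x, Valued.v c ≤ 1 → P x → P (c • x))
    (hmem : ∀ x ∈ N, P ((1 : v.adicCompletion K) ⊗ₜ[K] x))
    {w : (v.adicCompletion K) ⊗[K] V} (hw : w ∈ latCompletion v N) : P w := by
  unfold latCompletion at hw
  induction hw using Submodule.span_induction with
  | mem x hx => obtain ⟨y, hy, rfl⟩ := hx; exact hmem y hy
  | zero => exact h0
  | add x y _ _ hx hy => exact hadd x y hx hy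
  | smul a x _ hx => exact hsmul a.1 x a.2 hx

lemma latC_mono (v : HeightOneSpectrum (𝓞 K)) {N N' : Submodule (𝓞 K) V} (h : N ≤ N') :
    latCompletion v N ≤ latCompletion v N' :=
  Submodule.span_mono (Set.image_mono h)

lemma hv_approx (v : HeightOneSpectrum (𝓞 K)) {a : v.adicCompletion K} (ha : Valued.v a ≤ 1)
    {d : 𝓞 K} (hd : d ≠ 0) : ∃ (r : 𝓞 K) (c : v.adicCompletion K), Valued.v c ≤ 1 ∧
      a = algebraMap K (v.adicCompletion K) (algebraMap (𝓞 K) K r) +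
        algebraMap K (v.adicCompletion K) (algebraMap (𝓞 K) K d) * c := by
  set D := algebraMap K (v.adicCompletion K) (algebraMap (𝓞 K) K d) with hD
  have hD0 : D ≠ 0 := hv_val_ne v hd
  have hvD : Valued.v D ≠ 0 := (Valuation.ne_zero_iff _).2 hD0
  have hDle : Valued.v D ≤ 1 := hv_val_le v d
  obtain ⟨k, hk⟩ : ∃ k : K, Valued.v (a - algebraMap K (v.adicCompletion K) k) < Valued.v D := by
    have hopen : IsOpen {x : v.adicCompletion K | Valued.v (a - x) < Valued.v D} := by
      have h1 : IsOpen {x : v.adicCompletion K | Valued.v x < Valued.v D} :=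
        (by simpa [Valuation.restrict_lt_iff] using
          Valued.isOpen_ball (v.adicCompletion K) (Valued.v.restrict D))
      exact h1.preimage (continuous_const.sub continuous_id)
    obtain ⟨k, hk⟩ := (HeightOneSpectrum.denseRange_algebraMap K v).exists_mem_open hopen
      ⟨a, by simpa using zero_lt_iff.2 hvD⟩
    exact ⟨k, hk⟩
  have hk1 : v.valuation K k ≤ 1 := by
    rw [← hv_val]
    have : algebraMap K (v.adicCompletion K) k = a - (a - algebraMap K (v.adicCompletion K) k) := by
      ring
    rw [this]
    exact (Valuation.map_sub _ _ _).trans (max_le ha (hk.le.trans hDle))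
  obtain ⟨r, hr⟩ := v.exists_valuation_sub_lt_of_integer hk1 (Units.mk0 _ hvD)
  refine ⟨r, D⁻¹ * (a - algebraMap K (v.adicCompletion K) (algebraMap (𝓞 K) K r)), ?_, ?_⟩
  · rw [map_mul, map_inv₀, inv_mul_le_iff₀ (zero_lt_iff.2 hvD), mul_one]
    have : a - algebraMap K (v.adicCompletion K) (algebraMap (𝓞 K) K r) =
        (a - algebraMap K (v.adicCompletion K) k) -
          algebraMap K (v.adicCompletion K) (algebraMap (𝓞 K) K r - k) := by
      rw [map_sub]; ring
    rw [this]
    refine (Valuation.map_sub _ _ _).trans (max_le hk.le ?_)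
    rw [hv_val]
    exact hr.le
  · rw [mul_inv_cancel_left₀ hD0]; ring

lemma latC_dense (v : HeightOneSpectrum (𝓞 K)) (N : Submodule (𝓞 K) V)
    {d : 𝓞 K} (hd : d ≠ 0) {w : (v.adicCompletion K) ⊗[K] V} (hw : w ∈ latCompletion v N) :
    ∃ n ∈ N, ∃ z ∈ latCompletion v N, w = (1 : v.adicCompletion K) ⊗ₜ[K] n +
      algebraMap K (v.adicCompletion K) (algebraMap (𝓞 K) K d) • z := by
  refine latC_induction v N (P := fun w => ∃ n ∈ N, ∃ z ∈ latCompletion v N,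
    w = (1 : v.adicCompletion K) ⊗ₜ[K] n +
      algebraMap K (v.adicCompletion K) (algebraMap (𝓞 K) K d) • z) ?_ ?_ ?_ ?_ hw
  · exact ⟨0, zero_mem _, 0, zero_mem _, by simp⟩
  · intro x y hx hy
    obtain ⟨n, hn, z, hz, rfl⟩ := hx
    obtain ⟨n', hn', z', hz', rfl⟩ := hy
    refine ⟨n + n', add_mem hn hn', z + z', add_mem hz hz', ?_⟩
    rw [TensorProduct.tmul_add, smul_add]; abel
  · intro a x ha hx
    obtain ⟨n, hn, z, hz, rfl⟩ := hx
    obtain ⟨r, c, hc, rfl⟩ := hv_approx v ha hd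
    refine ⟨r • n, N.smul_mem r hn, c • ((1 : v.adicCompletion K) ⊗ₜ[K] n) +
      (algebraMap K (v.adicCompletion K) (algebraMap (𝓞 K) K r) +
        algebraMap K (v.adicCompletion K) (algebraMap (𝓞 K) K d) * c) • z,
      add_mem (latC_smul v N hc (latC_of_mem v hn)) (latC_smul v N ha hz), ?_⟩
    rw [← algebraMap_smul K r n, ← hv_one_tmul_smul]
    module
  · intro x hx; exact ⟨x, hx, 0, zero_mem _, by simp⟩

/-- common multiplier -/
lemma exists_common_mult {α : Type*} (S : Finset α) (v : HeightOneSpectrum (𝓞 K))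
    (P : α → 𝓞 K → Prop) (hP : ∀ i s t, P i s → P i (t * s))
    (h : ∀ i ∈ S, ∃ s, s ∉ v.asIdeal ∧ P i s) : ∃ s, s ∉ v.asIdeal ∧ ∀ i ∈ S, P i s := by
  classical
  induction S using Finset.induction_on with
  | empty => exact ⟨1, (Ideal.ne_top_iff_one _).1 v.isPrime.ne_top, by simp⟩
  | insert a S _ ih =>
    obtain ⟨s, hs, hs'⟩ := ih (fun i hi => h i (Finset.mem_insert_of_mem hi))
    obtain ⟨t, ht, ht'⟩ := h a (Finset.mem_insert_self _ _)
    refine ⟨s * t, fun hm => (v.isPrime.mem_or_mem hm).elim hs ht, fun i hi => ?_⟩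
    rcases Finset.mem_insert.1 hi with rfl | hi
    · exact hP _ _ _ ht'
    · rw [mul_comm]; exact hP _ _ _ (hs' i hi)

lemma exists_mult_int (v : HeightOneSpectrum (𝓞 K)) (c : K) (hc : v.valuation K c ≤ 1) :
    ∃ s : 𝓞 K, s ∉ v.asIdeal ∧ ∃ r : 𝓞 K, algebraMap (𝓞 K) K s * c = algebraMap (𝓞 K) K r := by
  obtain ⟨n, d, h⟩ := v.exists_primeCompl_mul_eq_of_integer c hc
  exact ⟨d, d.2, n, by rw [mul_comm]; exact h⟩

/-- a lattice membership is detected locally -/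
lemma latC_detect (v : HeightOneSpectrum (𝓞 K)) {N : Submodule (𝓞 K) V} (hN : IsZLat N)
    {x : V} (hx : (1 : v.adicCompletion K) ⊗ₜ[K] x ∈ latCompletion v N) :
    ∃ s : 𝓞 K, s ∉ v.asIdeal ∧ s • x ∈ N := by
  classical
  obtain ⟨hfg, hspan⟩ := hN
  obtain ⟨B, hBN, hBspan, hBli⟩ := exists_linearIndependent K (N : Set V)
  let b : Module.Basis B K V := Module.Basis.mk hBli (by
    rw [Subtype.range_coe, hBspan, hspan])
  have hbN : ∀ i, b i ∈ N := fun i => by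
    simp only [b, Module.Basis.mk_apply]; exact hBN i.2
  obtain ⟨S, hS⟩ := hfg
  obtain ⟨d, hd⟩ := IsLocalization.exist_integer_multiples_of_finset (𝓞 K)⁰
    (S.biUnion fun y => (b.repr y).support.image (b.repr y))
  have hd0 : (d : 𝓞 K) ≠ 0 := nonZeroDivisors.ne_zero d.2
  have hcoord : ∀ y ∈ N, ∀ i, ∃ r : 𝓞 K, algebraMap (𝓞 K) K r =
      algebraMap (𝓞 K) K d * b.repr y i := by
    intro y hy i
    rw [← hS] at hy
    induction hy using Submodule.span_induction with
    | mem y hy =>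
      by_cases h0 : b.repr y i = 0
      · exact ⟨0, by simp [h0]⟩
      · obtain ⟨r, hr⟩ := hd (b.repr y i) (Finset.mem_biUnion.2 ⟨y, hy, Finset.mem_image.2
          ⟨i, by simpa using h0, rfl⟩⟩)
        exact ⟨r, by rw [hr, Algebra.smul_def]⟩
    | zero => exact ⟨0, by simp⟩
    | add y z _ _ hy hz =>
      obtain ⟨r, hr⟩ := hy
      obtain ⟨r', hr'⟩ := hz
      exact ⟨r + r', by simp [hr, hr', mul_add]⟩
    | smul a y _ hy =>
      obtain ⟨r, hr⟩ := hy
      refine ⟨a * r, ?_⟩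
      rw [← algebraMap_smul K a y, map_smul, Finsupp.smul_apply, map_mul, hr, smul_eq_mul]
      ring
  let bb := Algebra.TensorProduct.basis (v.adicCompletion K) b
  have hbb : ∀ (y : V) i, bb.repr ((1 : v.adicCompletion K) ⊗ₜ[K] y) i =
      algebraMap K (v.adicCompletion K) (b.repr y i) := by
    intro y i
    simp only [bb]
    rw [Algebra.TensorProduct.basis_repr_tmul]
    simp
  have hloc : ∀ w ∈ latCompletion v N, ∀ i,
      Valued.v (algebraMap K (v.adicCompletion K) (algebraMap (𝓞 K) K d) * bb.repr w i) ≤ 1 := by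
    intro w hw i
    refine latC_induction v N (P := fun w => Valued.v (algebraMap K (v.adicCompletion K)
      (algebraMap (𝓞 K) K d) * bb.repr w i) ≤ 1) ?_ ?_ ?_ ?_ hw
    · simp
    · intro x y hx hy
      rw [map_add, Finsupp.add_apply, mul_add]
      exact (Valuation.map_add _ _ _).trans (max_le hx hy)
    · intro c x hc hx
      rw [map_smul, Finsupp.smul_apply, smul_eq_mul, mul_left_comm, map_mul]
      exact mul_le_one' hc hx
    · intro y hy
      rw [hbb, ← map_mul]
      obtain ⟨r, hr⟩ := hcoord y hy i
      rw [← hr]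
      exact hv_val_le v r
  obtain ⟨n, hn, z, hz, h⟩ := latC_dense v N hd0 hx
  have hxn : ∀ i, v.valuation K (b.repr (x - n) i) ≤ 1 := by
    intro i
    rw [← hv_val, ← hbb, TensorProduct.tmul_sub, h, add_sub_cancel_left, map_smul,
      Finsupp.smul_apply, smul_eq_mul]
    exact hloc z hz i
  obtain ⟨s, hs, hs'⟩ := exists_common_mult (b.repr (x - n)).support v
    (fun i s => ∃ r : 𝓞 K, algebraMap (𝓞 K) K s * b.repr (x - n) i = algebraMap (𝓞 K) K r)
    (by
      rintro i s t ⟨r, hr⟩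
      exact ⟨t * r, by rw [map_mul, map_mul, mul_assoc, hr]⟩)
    (fun i _ => exists_mult_int v _ (hxn i))
  refine ⟨s, hs, ?_⟩
  have hsn : s • (x - n) ∈ N := by
    rw [← b.linearCombination_repr (x - n), Finsupp.linearCombination_apply, Finsupp.sum,
      Finset.smul_sum]
    refine Submodule.sum_mem _ fun i hi => ?_
    obtain ⟨r, hr⟩ := hs' i hi
    rw [← algebraMap_smul K s, smul_smul, hr, algebraMap_smul]
    exact N.smul_mem r (hbN i)
  have : s • x = s • (x - n) + s • n := by rw [← smul_add]; simp
  rw [this]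
  exact add_mem hsn (N.smul_mem s hn)

lemma mem_smulLatK_iff (I J : FractionalIdeal (𝓞 K)⁰ K) (hIJ : I * J = 1)
    (N : Submodule (𝓞 K) V) (y : V) :
    y ∈ smulLatK (I : Submodule (𝓞 K) K) N ↔ ∀ b ∈ J, b • y ∈ N := by
  constructor
  · intro hy b hb
    unfold smulLatK at hy
    induction hy using Submodule.span_induction with
    | mem x hx =>
      obtain ⟨a, ha, n, hn, rfl⟩ := hx
      have h1 : a * b ∈ I * J := FractionalIdeal.mul_mem_mul ha hb
      rw [hIJ, FractionalIdeal.mem_one_iff] at h1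
      obtain ⟨r, hr⟩ := h1
      simp only
      rw [smul_smul, mul_comm, ← hr, algebraMap_smul]
      exact N.smul_mem r hn
    | zero => simp
    | add x y _ _ hx hy => rw [smul_add]; exact add_mem hx hy
    | smul r x _ hx =>
      rw [← algebraMap_smul K r x, smul_comm, algebraMap_smul]
      exact N.smul_mem r hx
  · intro h
    have key : ∀ c ∈ I * J, c • y ∈ smulLatK (I : Submodule (𝓞 K) K) N := by
      intro c hc
      refine FractionalIdeal.mul_induction_on hc ?_ ?_
      · intro a ha b hb
        rw [mul_smul]
        exact Submodule.subset_span ⟨a, ha, b • y, h b hb, rfl⟩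
      · intro x y hx hy; rw [add_smul]; exact add_mem hx hy
    have := key 1 (by rw [hIJ]; exact FractionalIdeal.one_mem_one _)
    rwa [one_smul] at this

lemma mem_rhoK_iff (Φ : LinearMap.BilinForm K V) {p : Ideal (𝓞 K)} (hp : p ≠ ⊥)
    (L : Submodule (𝓞 K) V) (x : V) :
    x ∈ rhoK Φ p L ↔ ∃ l ∈ L, ∃ e : V, ((∀ a ∈ p, a • e ∈ L) ∧
      (∀ n ∈ L, ∃ r ∈ p, algebraMap (𝓞 K) K r = Φ e n)) ∧ l + e = x := by
  have hpp : (p : FractionalIdeal (𝓞 K)⁰ K) * (p : FractionalIdeal (𝓞 K)⁰ K)⁻¹ = 1 :=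
    FractionalIdeal.coe_ideal_mul_inv p hp
  have hp0 : (p : FractionalIdeal (𝓞 K)⁰ K) ≠ 0 := by simpa using hp
  have h1 : ∀ e : V, e ∈ smulLatK ((((p : FractionalIdeal (𝓞 K)⁰ K))⁻¹ :
      FractionalIdeal (𝓞 K)⁰ K) : Submodule (𝓞 K) K) L ↔ ∀ a ∈ p, a • e ∈ L := by
    intro e
    rw [mem_smulLatK_iff _ (p : FractionalIdeal (𝓞 K)⁰ K) (by rw [mul_comm]; exact hpp)]
    constructor
    · intro h a ha
      rw [← algebraMap_smul K a e]
      exact h _ (FractionalIdeal.mem_coeIdeal_of_mem _ ha)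
    · intro h b hb
      obtain ⟨a, ha, rfl⟩ := (FractionalIdeal.mem_coeIdeal _).1 hb
      rw [algebraMap_smul]; exact h a ha
  have h2 : ∀ e : V, e ∈ smulLatK (((p : FractionalIdeal (𝓞 K)⁰ K)) : Submodule (𝓞 K) K)
      (dualLatK Φ L) ↔ ∀ n ∈ L, ∃ r ∈ p, algebraMap (𝓞 K) K r = Φ e n := by
    intro e
    rw [mem_smulLatK_iff _ _ hpp]
    constructor
    · intro h n hn
      have h3 : Φ e n ∈ ((p : FractionalIdeal (𝓞 K)⁰ K)⁻¹)⁻¹ := by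
        rw [FractionalIdeal.mem_inv_iff (inv_ne_zero hp0)]
        intro b hb
        obtain ⟨r, hr⟩ := h b hb n hn
        rw [map_smul, LinearMap.smul_apply, smul_eq_mul, mul_comm] at hr
        rw [FractionalIdeal.mem_one_iff]
        exact ⟨r, hr⟩
      rw [inv_inv] at h3
      exact (FractionalIdeal.mem_coeIdeal _).1 h3
    · intro h b hb n hn
      obtain ⟨r, hr, hrn⟩ := h n hn
      rw [map_smul, LinearMap.smul_apply, smul_eq_mul, mul_comm, ← hrn]
      have h3 : algebraMap (𝓞 K) K r * b ∈ (p : FractionalIdeal (𝓞 K)⁰ K) *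
        (p : FractionalIdeal (𝓞 K)⁰ K)⁻¹ :=
        FractionalIdeal.mul_mem_mul (FractionalIdeal.mem_coeIdeal_of_mem _ hr) hb
      rw [hpp, FractionalIdeal.mem_one_iff] at h3
      obtain ⟨t, ht⟩ := h3
      exact ⟨t, ht⟩
  unfold rhoK
  simp only [Submodule.mem_sup, Submodule.mem_inf, h1, h2]

lemma le_rhoK (Φ : LinearMap.BilinForm K V) (p : Ideal (𝓞 K)) (L : Submodule (𝓞 K) V) :
    L ≤ rhoK Φ p L := le_sup_left

lemma smul_rhoK (Φ : LinearMap.BilinForm K V) {p : Ideal (𝓞 K)} (hp : p ≠ ⊥)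
    {L : Submodule (𝓞 K) V} {a : 𝓞 K} (ha : a ∈ p) {x : V} (hx : x ∈ rhoK Φ p L) :
    a • x ∈ L := by
  obtain ⟨l, hl, e, ⟨he, _⟩, rfl⟩ := (mem_rhoK_iff Φ hp L x).1 hx
  rw [smul_add]
  exact add_mem (L.smul_mem a hl) (he a ha)

lemma isZLat_of_between {N N' : Submodule (𝓞 K) V} {a : 𝓞 K} (ha : a ≠ 0)
    (h1 : N ≤ N') (h2 : ∀ x ∈ N', a • x ∈ N) : (IsZLat N ↔ IsZLat N') := by
  have ha' : algebraMap (𝓞 K) K a ≠ 0 := by simpa using ha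
  constructor
  · rintro ⟨hfg, hs⟩
    refine ⟨?_, top_le_iff.1 (hs ▸ Submodule.span_mono h1)⟩
    have : IsNoetherian (𝓞 K) N := isNoetherian_of_fg_of_noetherian N hfg
    let f : N' →ₗ[𝓞 K] N :=
      { toFun := fun x => ⟨a • x.1, h2 x.1 x.2⟩
        map_add' := fun x y => by ext; simp
        map_smul' := fun r x => by ext; simp [smul_comm a r] }
    have hf : Function.Injective f := by
      intro x y hxy
      have : a • x.1 = a • y.1 := congrArg Subtype.val hxy
      rw [← algebraMap_smul K a x.1, ← algebraMap_smul K a y.1] at this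
      exact Subtype.ext (smul_right_injective V ha' this)
    have : IsNoetherian (𝓞 K) N' := isNoetherian_of_injective f hf
    exact (Submodule.fg_top N').1 (IsNoetherian.noetherian _)
  · rintro ⟨hfg, hs⟩
    have : IsNoetherian (𝓞 K) N' := isNoetherian_of_fg_of_noetherian N' hfg
    refine ⟨?_, top_le_iff.1 (hs ▸ Submodule.span_le.2 ?_)⟩
    · have : IsNoetherian (𝓞 K) N :=
        isNoetherian_of_injective (Submodule.inclusion h1) (Submodule.inclusion_injective h1)
      exact (Submodule.fg_top N).1 (IsNoetherian.noetherian _)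
    · intro x hx
      have h3 : (algebraMap (𝓞 K) K a)⁻¹ • (a • x) ∈ Submodule.span K (N : Set V) :=
        Submodule.smul_mem _ _ (Submodule.subset_span (h2 x hx))
      rwa [← algebraMap_smul K a x, smul_smul, inv_mul_cancel₀ ha', one_smul] at h3

lemma latC_eq_of_between (v : HeightOneSpectrum (𝓞 K)) {N N' : Submodule (𝓞 K) V} {a : 𝓞 K}
    (ha : a ∉ v.asIdeal) (h1 : N ≤ N') (h2 : ∀ x ∈ N', a • x ∈ N) :
    latCompletion v N = latCompletion v N' := by
  refine le_antisymm (latC_mono v h1) fun w hw => ?_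
  have hval : Valued.v (algebraMap K (v.adicCompletion K) (algebraMap (𝓞 K) K a)) = 1 := by
    rw [hv_val]; exact v.valuation_eq_one_iff_notMem.2 ha
  have hne : algebraMap K (v.adicCompletion K) (algebraMap (𝓞 K) K a) ≠ 0 := by
    intro h; rw [h] at hval; simp at hval
  refine latC_induction v N' (P := fun w => w ∈ latCompletion v N) (zero_mem _)
    (fun x y hx hy => add_mem hx hy) (fun c x hc hx => latC_smul v N hc hx) ?_ hw
  intro x hx
  have h3 := latC_smul v N (c := (algebraMap K (v.adicCompletion K) (algebraMap (𝓞 K) K a))⁻¹)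
    (by rw [map_inv₀, hval, inv_one]) (latC_of_mem v (h2 x hx))
  rwa [← algebraMap_smul K a x, ← hv_one_tmul_smul, smul_smul, inv_mul_cancel₀ hne,
    one_smul] at h3

/-- the local version of the correction term -/
def ELoc (Φ : LinearMap.BilinForm K V) (v : HeightOneSpectrum (𝓞 K))
    (N : Set ((v.adicCompletion K) ⊗[K] V)) (y : (v.adicCompletion K) ⊗[K] V) : Prop :=
  (∀ a ∈ v.asIdeal, algebraMap K (v.adicCompletion K) (algebraMap (𝓞 K) K a) • y ∈ N) ∧
  ∀ n ∈ N, Valued.v (Φ.baseChange (v.adicCompletion K) y n) < 1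

/-- the local version of the operator -/
def rhoLoc (Φ : LinearMap.BilinForm K V) (v : HeightOneSpectrum (𝓞 K))
    (N : Set ((v.adicCompletion K) ⊗[K] V)) : Set ((v.adicCompletion K) ⊗[K] V) :=
  {w | ∃ l ∈ N, ∃ e, ELoc Φ v N e ∧ l + e = w}

lemma rhoLoc_image (Φ : LinearMap.BilinForm K V) (v : HeightOneSpectrum (𝓞 K))
    (N : Set ((v.adicCompletion K) ⊗[K] V))
    (g : ((v.adicCompletion K) ⊗[K] V) ≃ₗ[v.adicCompletion K] ((v.adicCompletion K) ⊗[K] V))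
    (hg : ∀ x y, Φ.baseChange (v.adicCompletion K) (g x) (g y) =
        Φ.baseChange (v.adicCompletion K) x y) :
    rhoLoc Φ v (⇑g '' N) = ⇑g '' rhoLoc Φ v N := by
  have hE : ∀ e, ELoc Φ v (⇑g '' N) (g e) ↔ ELoc Φ v N e := by
    intro e
    unfold ELoc
    refine and_congr ?_ ?_
    · refine forall₂_congr fun a _ => ?_
      rw [← map_smul]
      exact g.injective.mem_set_image
    · rw [Set.forall_mem_image]
      simp only [hg]
  ext w
  constructor
  · rintro ⟨_, ⟨l, hl, rfl⟩, e, he, rfl⟩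
    obtain ⟨e, rfl⟩ := g.surjective e
    exact ⟨l + e, ⟨l, hl, e, (hE e).1 he, rfl⟩, map_add _ _ _⟩
  · rintro ⟨_, ⟨l, hl, e, he, rfl⟩, rfl⟩
    exact ⟨g l, ⟨l, hl, rfl⟩, g e, (hE e).2 he, (map_add _ _ _).symm⟩

lemma baseChange_one (Φ : LinearMap.BilinForm K V) (v : HeightOneSpectrum (𝓞 K)) (x y : V) :
    Φ.baseChange (v.adicCompletion K) ((1 : v.adicCompletion K) ⊗ₜ[K] x)
      ((1 : v.adicCompletion K) ⊗ₜ[K] y) = algebraMap K (v.adicCompletion K) (Φ x y) := by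
  rw [LinearMap.BilinForm.baseChange_tmul, mul_one, Algebra.smul_def, mul_one]

/-- bound extends to the completion in the second variable -/
lemma val_bound (Φ : LinearMap.BilinForm K V) (v : HeightOneSpectrum (𝓞 K))
    (N : Submodule (𝓞 K) V) (y : (v.adicCompletion K) ⊗[K] V)
    (h : ∀ n ∈ N, Valued.v (Φ.baseChange (v.adicCompletion K) y
      ((1 : v.adicCompletion K) ⊗ₜ[K] n)) < 1) :
    ∀ n ∈ latCompletion v N, Valued.v (Φ.baseChange (v.adicCompletion K) y n) < 1 := by
  intro n hn
  refine latC_induction v N (P := fun n => Valued.v (Φ.baseChange (v.adicCompletion K) y n) < 1)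
    ?_ ?_ ?_ h hn
  · simp
  · intro a b ha hb
    rw [map_add]
    exact (Valuation.map_add _ _ _).trans_lt (max_lt ha hb)
  · intro c a hc ha
    rw [map_smul, smul_eq_mul, map_mul]
    exact (mul_le_of_le_one_left' hc).trans_lt ha

lemma exists_form_denom (Φ : LinearMap.BilinForm K V) {N : Submodule (𝓞 K) V} (hN : N.FG) :
    ∃ d : 𝓞 K, d ≠ 0 ∧ ∀ x ∈ N, ∀ y ∈ N, ∃ r : 𝓞 K,
      algebraMap (𝓞 K) K r = algebraMap (𝓞 K) K d * Φ x y := by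
  classical
  obtain ⟨S, rfl⟩ := hN
  obtain ⟨d, hd⟩ := IsLocalization.exist_integer_multiples_of_finset (𝓞 K)⁰
    ((S ×ˢ S).image fun z => Φ z.1 z.2)
  refine ⟨d, nonZeroDivisors.ne_zero d.2, ?_⟩
  intro x hx y hy
  induction hx, hy using Submodule.span_induction₂ with
  | mem_mem x y hx hy =>
    obtain ⟨r, hr⟩ := hd (Φ x y) (Finset.mem_image.2 ⟨(x, y), Finset.mem_product.2 ⟨hx, hy⟩, rfl⟩)
    exact ⟨r, by rw [hr, Algebra.smul_def]⟩
  | zero_left y hy => exact ⟨0, by simp⟩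
  | zero_right x hx => exact ⟨0, by simp⟩
  | add_left x y z _ _ _ h1 h2 =>
    obtain ⟨r, hr⟩ := h1
    obtain ⟨t, ht⟩ := h2
    exact ⟨r + t, by simp [hr, ht, mul_add]⟩
  | add_right x y z _ _ _ h1 h2 =>
    obtain ⟨r, hr⟩ := h1
    obtain ⟨t, ht⟩ := h2
    exact ⟨r + t, by simp [hr, ht, mul_add]⟩
  | smul_left a x y _ _ h =>
    obtain ⟨r, hr⟩ := h
    refine ⟨a * r, ?_⟩
    rw [← algebraMap_smul K a x, map_smul, LinearMap.smul_apply, map_mul, hr, smul_eq_mul]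
    ring
  | smul_right a x y _ _ h =>
    obtain ⟨r, hr⟩ := h
    refine ⟨a * r, ?_⟩
    rw [← algebraMap_smul K a y, map_smul, map_mul, hr, smul_eq_mul]
    ring

lemma exists_ne_zero_mem (v : HeightOneSpectrum (𝓞 K)) : ∃ a ∈ v.asIdeal, a ≠ 0 :=
  Submodule.exists_mem_ne_zero_of_ne_bot v.ne_bot

lemma ELoc_smul (Φ : LinearMap.BilinForm K V) (v : HeightOneSpectrum (𝓞 K))
    (L : Submodule (𝓞 K) V) {c : v.adicCompletion K} (hc : Valued.v c ≤ 1)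
    {e : (v.adicCompletion K) ⊗[K] V} (he : ELoc Φ v (latCompletion v L) e) :
    ELoc Φ v (latCompletion v L) (c • e) := by
  refine ⟨fun a ha => ?_, fun n hn => ?_⟩
  · rw [smul_comm]; exact latC_smul v L hc (he.1 a ha)
  · rw [map_smul, LinearMap.smul_apply, smul_eq_mul, map_mul]
    exact (mul_le_of_le_one_left' hc).trans_lt (he.2 n hn)

lemma ELoc_add (Φ : LinearMap.BilinForm K V) (v : HeightOneSpectrum (𝓞 K))
    (L : Submodule (𝓞 K) V)
    {e e' : (v.adicCompletion K) ⊗[K] V} (he : ELoc Φ v (latCompletion v L) e)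
    (he' : ELoc Φ v (latCompletion v L) e') :
    ELoc Φ v (latCompletion v L) (e + e') := by
  refine ⟨fun a ha => ?_, fun n hn => ?_⟩
  · rw [smul_add]; exact add_mem (he.1 a ha) (he'.1 a ha)
  · rw [map_add, LinearMap.add_apply]
    exact (Valuation.map_add _ _ _).trans_lt (max_lt (he.2 n hn) (he'.2 n hn))

lemma val_lt_of_mem (v : HeightOneSpectrum (𝓞 K)) {r : 𝓞 K} (hr : r ∈ v.asIdeal) :
    Valued.v (algebraMap K (v.adicCompletion K) (algebraMap (𝓞 K) K r)) < 1 := by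
  rw [hv_val]
  exact (v.valuation_lt_one_iff_mem r).2 hr

lemma latC_rhoK_le (Φ : LinearMap.BilinForm K V) (v : HeightOneSpectrum (𝓞 K))
    (L : Submodule (𝓞 K) V) {w : (v.adicCompletion K) ⊗[K] V}
    (hw : w ∈ latCompletion v (rhoK Φ v.asIdeal L)) : w ∈ rhoLoc Φ v (latCompletion v L) := by
  refine latC_induction v _ (P := fun w => w ∈ rhoLoc Φ v (latCompletion v L)) ?_ ?_ ?_ ?_ hw
  · exact ⟨0, zero_mem _, 0, ⟨by simp, by simp⟩, by simp⟩
  · rintro _ _ ⟨l, hl, e, he, rfl⟩ ⟨l', hl', e', he', rfl⟩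
    exact ⟨l + l', add_mem hl hl', e + e', ELoc_add Φ v L he he', by abel⟩
  · rintro c _ hc ⟨l, hl, e, he, rfl⟩
    exact ⟨c • l, latC_smul v L hc hl, c • e, ELoc_smul Φ v L hc he, by rw [smul_add]⟩
  · intro x hx
    obtain ⟨l, hl, e, ⟨he1, he2⟩, rfl⟩ := (mem_rhoK_iff Φ v.ne_bot L x).1 hx
    refine ⟨_, latC_of_mem v hl, (1 : v.adicCompletion K) ⊗ₜ[K] e, ⟨fun a ha => ?_, ?_⟩,
      (TensorProduct.tmul_add _ _ _).symm⟩
    · rw [hv_one_tmul_smul, algebraMap_smul]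
      exact latC_of_mem v (he1 a ha)
    · refine val_bound Φ v L _ fun n hn => ?_
      obtain ⟨r, hr, hrn⟩ := he2 n hn
      rw [baseChange_one, ← hrn]
      exact val_lt_of_mem v hr

lemma latC_of_smul_mem (v : HeightOneSpectrum (𝓞 K)) {N : Submodule (𝓞 K) V} {s : 𝓞 K}
    (hs : s ∉ v.asIdeal) {x : V} (hx : s • x ∈ N) :
    (1 : v.adicCompletion K) ⊗ₜ[K] x ∈ latCompletion v N := by
  have hval : Valued.v (algebraMap K (v.adicCompletion K) (algebraMap (𝓞 K) K s)) = 1 := by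
    rw [hv_val]; exact v.valuation_eq_one_iff_notMem.2 hs
  have hne : algebraMap K (v.adicCompletion K) (algebraMap (𝓞 K) K s) ≠ 0 := by
    intro h; rw [h] at hval; simp at hval
  have h3 := latC_smul v N (c := (algebraMap K (v.adicCompletion K) (algebraMap (𝓞 K) K s))⁻¹)
    (by rw [map_inv₀, hval, inv_one]) (latC_of_mem v hx)
  rwa [← algebraMap_smul K s x, ← hv_one_tmul_smul, smul_smul, inv_mul_cancel₀ hne,
    one_smul] at h3

/-- a global vector that is locally in the correction term -/
lemma ELoc_global (Φ : LinearMap.BilinForm K V) (v : HeightOneSpectrum (𝓞 K))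
    {L : Submodule (𝓞 K) V} (hL : IsZLat L) {x : V}
    (hx : ELoc Φ v (latCompletion v L) ((1 : v.adicCompletion K) ⊗ₜ[K] x)) :
    (1 : v.adicCompletion K) ⊗ₜ[K] x ∈ latCompletion v (rhoK Φ v.asIdeal L) := by
  classical
  obtain ⟨S, hS⟩ := hL.1
  obtain ⟨T, hT⟩ := (IsNoetherian.noetherian v.asIdeal : v.asIdeal.FG)
  have hTv : ∀ t ∈ T, t ∈ v.asIdeal := fun t ht => hT ▸ Submodule.subset_span ht
  have hSL : ∀ n ∈ S, n ∈ L := fun t ht => hS ▸ Submodule.subset_span ht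
  obtain ⟨s, hs, hs1⟩ := exists_common_mult T v (fun t s => s • t • x ∈ L)
    (fun t s u h => by rw [mul_smul]; exact L.smul_mem u h)
    (fun t ht => latC_detect v hL (by
      have := hx.1 t (hTv t ht)
      rwa [hv_one_tmul_smul, algebraMap_smul] at this))
  obtain ⟨u, hu, hu1⟩ := exists_common_mult S v
    (fun n s => ∃ r : 𝓞 K, algebraMap (𝓞 K) K s * Φ x n = algebraMap (𝓞 K) K r)
    (by
      rintro i s t ⟨r, hr⟩
      exact ⟨t * r, by rw [map_mul, map_mul, mul_assoc, hr]⟩)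
    (fun n hn => exists_mult_int v _ (by
      have := hx.2 _ (latC_of_mem v (hSL n hn))
      rw [baseChange_one, hv_val] at this
      exact this.le))
  have hsu : s * u ∉ v.asIdeal := fun hm => (v.isPrime.mem_or_mem hm).elim hs hu
  have hlin : ∀ (r : 𝓞 K) (y z : V), Φ (r • y) z = algebraMap (𝓞 K) K r * Φ y z := by
    intro r y z
    rw [← algebraMap_smul K r y, map_smul, LinearMap.smul_apply, smul_eq_mul]
  have hlin' : ∀ (r : 𝓞 K) (y z : V), Φ y (r • z) = algebraMap (𝓞 K) K r * Φ y z := by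
    intro r y z
    rw [← algebraMap_smul K r z, map_smul, smul_eq_mul]
  refine latC_of_smul_mem v hsu ((mem_rhoK_iff Φ v.ne_bot L _).2
    ⟨0, zero_mem _, (s * u) • x, ⟨?_, ?_⟩, zero_add _⟩)
  · intro a ha
    rw [← hT] at ha
    induction ha using Submodule.span_induction with
    | mem t ht =>
      have : t • (s * u) • x = u • s • t • x := by
        simp only [smul_smul]; congr 1; ring
      rw [this]
      exact L.smul_mem u (hs1 t ht)
    | zero => simp
    | add a b _ _ ha hb => rw [add_smul]; exact add_mem ha hb
    | smul r a _ ha => rw [smul_assoc]; exact L.smul_mem r ha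
  · intro n hn
    have hint : ∃ r : 𝓞 K, algebraMap (𝓞 K) K r = Φ ((s * u) • x) n := by
      rw [← hS] at hn
      induction hn using Submodule.span_induction with
      | mem n hn =>
        obtain ⟨r, hr⟩ := hu1 n hn
        exact ⟨s * r, by rw [hlin, map_mul, map_mul, mul_assoc, hr]⟩
      | zero => exact ⟨0, by simp⟩
      | add a b _ _ ha hb =>
        obtain ⟨r, hr⟩ := ha
        obtain ⟨t, ht⟩ := hb
        exact ⟨r + t, by rw [map_add, map_add, hr, ht]⟩
      | smul r a _ ha =>
        obtain ⟨t, ht⟩ := ha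
        exact ⟨r * t, by rw [map_mul, ht, hlin']⟩
    obtain ⟨r, hr⟩ := hint
    refine ⟨r, ?_, hr⟩
    rw [← v.valuation_lt_one_iff_mem (K := K)]
    have h1 := hx.2 _ (latC_of_mem v hn)
    rw [baseChange_one, hv_val] at h1
    change v.valuation K (algebraMap (𝓞 K) K r) < 1
    rw [hr, hlin, map_mul]
    exact (mul_le_of_le_one_left' (v.valuation_le_one _)).trans_lt h1

lemma latC_rhoK (Φ : LinearMap.BilinForm K V) (v : HeightOneSpectrum (𝓞 K))
    {L : Submodule (𝓞 K) V} (hL : IsZLat L) :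
    (latCompletion v (rhoK Φ v.asIdeal L) : Set _) = rhoLoc Φ v (latCompletion v L) := by
  refine Set.Subset.antisymm (fun w hw => latC_rhoK_le Φ v L hw) ?_
  rintro _ ⟨l, hl, e, he, rfl⟩
  refine add_mem (latC_mono v (le_rhoK Φ _ L) hl) ?_
  obtain ⟨a, ha, ha0⟩ := exists_ne_zero_mem v
  obtain ⟨d, hd0, hd⟩ := exists_form_denom Φ hL.1
  obtain ⟨m, hm, z, hz, h⟩ := latC_dense v L (d := a * (a * d))
    (mul_ne_zero ha0 (mul_ne_zero ha0 hd0)) (he.1 a ha)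
  have hA0 := hv_val_ne v ha0
  have ha0' : algebraMap (𝓞 K) K a ≠ 0 := by simpa using ha0
  set A := algebraMap K (v.adicCompletion K) (algebraMap (𝓞 K) K a) with hA
  set D := algebraMap K (v.adicCompletion K) (algebraMap (𝓞 K) K d) with hD
  have hADle : Valued.v (A * D) ≤ 1 := by
    rw [map_mul]; exact mul_le_one' (hv_val_le v a) (hv_val_le v d)
  have hzL : (A * D) • z ∈ latCompletion v L := latC_smul v L hADle hz
  have he' : e = (1 : v.adicCompletion K) ⊗ₜ[K] ((algebraMap (𝓞 K) K a)⁻¹ • m) +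
      (A * D) • z := by
    rw [← hv_one_tmul_smul, map_inv₀]
    apply smul_right_injective _ hA0
    simp only
    rw [h, smul_add, smul_smul, smul_smul, mul_inv_cancel₀ hA0, one_smul, map_mul, map_mul,
      map_mul, map_mul]
  have hEz : ELoc Φ v (latCompletion v L) ((A * D) • z) := by
    refine ⟨fun b _ => latC_smul v L (hv_val_le v b) hzL, ?_⟩
    refine val_bound Φ v L _ fun n hn => ?_
    rw [mul_smul, map_smul, LinearMap.smul_apply, smul_eq_mul, map_mul]
    refine (mul_le_of_le_one_right' ?_).trans_lt (val_lt_of_mem v ha)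
    refine latC_induction v L (P := fun z => Valued.v (Φ.baseChange (v.adicCompletion K) (D • z)
      ((1 : v.adicCompletion K) ⊗ₜ[K] n)) ≤ 1) ?_ ?_ ?_ ?_ hz
    · simp
    · intro x y hx hy
      rw [smul_add, map_add, LinearMap.add_apply]
      exact (Valuation.map_add _ _ _).trans (max_le hx hy)
    · intro c x hc hx
      rw [smul_comm, map_smul, LinearMap.smul_apply, smul_eq_mul, map_mul]
      exact mul_le_one' hc hx
    · intro x hx
      rw [map_smul, LinearMap.smul_apply, smul_eq_mul, baseChange_one, ← map_mul]
      obtain ⟨r, hr⟩ := hd x hx n hn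
      rw [← hr]
      exact hv_val_le v r
  have hEx : ELoc Φ v (latCompletion v L)
      ((1 : v.adicCompletion K) ⊗ₜ[K] ((algebraMap (𝓞 K) K a)⁻¹ • m)) := by
    have : (1 : v.adicCompletion K) ⊗ₜ[K] ((algebraMap (𝓞 K) K a)⁻¹ • m) =
        e + (-1 : v.adicCompletion K) • ((A * D) • z) := by
      rw [he']; module
    rw [this]
    exact ELoc_add Φ v L he (ELoc_smul Φ v L (by simp) hEz)
  rw [he']
  exact add_mem (ELoc_global Φ v hL hEx) (latC_mono v (le_rhoK Φ _ L) hzL)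

lemma exists_mem_notMem {v w : HeightOneSpectrum (𝓞 K)} (h : w ≠ v) :
    ∃ a ∈ v.asIdeal, a ∉ w.asIdeal := by
  by_contra! hcon
  have hle : v.asIdeal ≤ w.asIdeal := hcon
  exact h (HeightOneSpectrum.ext (v.isMaximal.eq_of_le w.isPrime.ne_top hle).symm)

lemma latC_rhoK_away (Φ : LinearMap.BilinForm K V) {v w : HeightOneSpectrum (𝓞 K)} (h : w ≠ v)
    (L : Submodule (𝓞 K) V) :
    latCompletion w L = latCompletion w (rhoK Φ v.asIdeal L) := by
  obtain ⟨a, ha, haw⟩ := exists_mem_notMem h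
  exact latC_eq_of_between w haw (le_rhoK Φ _ L) fun x hx => smul_rhoK Φ v.ne_bot ha hx

lemma isZLat_rhoK (Φ : LinearMap.BilinForm K V) (v : HeightOneSpectrum (𝓞 K))
    {L : Submodule (𝓞 K) V} (hL : IsZLat L) : IsZLat (rhoK Φ v.asIdeal L) := by
  obtain ⟨a, ha, ha0⟩ := exists_ne_zero_mem v
  exact (isZLat_of_between ha0 (le_rhoK Φ _ L) fun x hx => smul_rhoK Φ v.ne_bot ha hx).1 hL

lemma sameGenus_rhoK (Φ : LinearMap.BilinForm K V) (v : HeightOneSpectrum (𝓞 K))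
    {L M : Submodule (𝓞 K) V} (hL : IsZLat L) (hM : IsZLat M)
    (h : SameGenus Φ (fun _ : Fin 1 => L) (fun _ => M)) :
    SameGenus Φ (fun _ : Fin 1 => rhoK Φ v.asIdeal L) (fun _ => rhoK Φ v.asIdeal M) := by
  intro w
  obtain ⟨g, hg, hgL⟩ := h w
  refine ⟨g, hg, fun i => ?_⟩
  have hgL := hgL i
  by_cases hw : w = v
  · subst hw
    simp only at hgL ⊢
    rw [latC_rhoK Φ w hL, latC_rhoK Φ w hM, ← rhoLoc_image Φ w _ g hg, hgL]
  · simp only at hgL ⊢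
    rw [← latC_rhoK_away Φ hw, ← latC_rhoK_away Φ hw, hgL]

lemma mem_of_latC (v : HeightOneSpectrum (𝓞 K)) {N : Submodule (𝓞 K) V} (hN : IsZLat N)
    {x : V} (hp : ∀ a ∈ v.asIdeal, a • x ∈ N)
    (hx : (1 : v.adicCompletion K) ⊗ₜ[K] x ∈ latCompletion v N) : x ∈ N := by
  obtain ⟨s, hs, hsx⟩ := latC_detect v hN hx
  obtain ⟨t, ht⟩ := v.isMaximal.exists_inv hs
  obtain ⟨i, hi, hti⟩ := ht
  have : x = t • s • x + i • x := by rw [smul_smul, ← add_smul, hti, one_smul]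
  rw [this]
  exact add_mem (N.smul_mem t hsx) (hp i hi)

lemma exists_rhoK_eq (Φ : LinearMap.BilinForm K V) (v : HeightOneSpectrum (𝓞 K))
    {L M' : Submodule (𝓞 K) V} (hL : IsZLat L) (hM' : IsZLat M')
    (h : SameGenus Φ (fun _ : Fin 1 => rhoK Φ v.asIdeal L) (fun _ => M')) :
    ∃ M, IsZLat M ∧ SameGenus Φ (fun _ : Fin 1 => L) (fun _ => M) ∧ rhoK Φ v.asIdeal M = M' := by
  obtain ⟨g, hg, hgL⟩ := h v
  have hgL := hgL 0
  simp only at hgL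
  let M : Submodule (𝓞 K) V :=
    { carrier := {x | x ∈ M' ∧ (1 : v.adicCompletion K) ⊗ₜ[K] x ∈
        ⇑g '' (latCompletion v L : Set _)}
      add_mem' := by
        rintro x y ⟨hx, l, hl, hlx⟩ ⟨hy, l', hl', hly⟩
        exact ⟨add_mem hx hy, l + l', add_mem hl hl', by
          rw [map_add, hlx, hly, TensorProduct.tmul_add]⟩
      zero_mem' := ⟨zero_mem _, 0, zero_mem _, by simp⟩
      smul_mem' := by
        rintro c x ⟨hx, l, hl, hlx⟩
        refine ⟨M'.smul_mem c hx, _, latC_smul v L (hv_val_le v c) hl, ?_⟩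
        rw [map_smul, hlx, hv_one_tmul_smul, algebraMap_smul] }
  have hMM' : M ≤ M' := fun x hx => hx.1
  have haloc : ∀ a ∈ v.asIdeal, ∀ w ∈ latCompletion v M',
      algebraMap K (v.adicCompletion K) (algebraMap (𝓞 K) K a) • w ∈
        ⇑g '' (latCompletion v L : Set _) := by
    intro a ha w hw
    have hw' : w ∈ (latCompletion v M' : Set _) := hw
    rw [← hgL] at hw'
    obtain ⟨u, hu, rfl⟩ := hw'
    refine ⟨algebraMap K (v.adicCompletion K) (algebraMap (𝓞 K) K a) • u, ?_, map_smul _ _ _⟩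
    refine latC_induction v _ (P := fun u => algebraMap K (v.adicCompletion K)
      (algebraMap (𝓞 K) K a) • u ∈ latCompletion v L) ?_ ?_ ?_ ?_ hu
    · simp
    · intro x y hx hy; rw [smul_add]; exact add_mem hx hy
    · intro c x hc hx; rw [smul_comm]; exact latC_smul v L hc hx
    · intro x hx
      rw [hv_one_tmul_smul, algebraMap_smul]
      exact latC_of_mem v (smul_rhoK Φ v.ne_bot ha hx)
  have hpM : ∀ a ∈ v.asIdeal, ∀ x ∈ M', a • x ∈ M := by
    intro a ha x hx
    refine ⟨M'.smul_mem a hx, ?_⟩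
    have := haloc a ha _ (latC_of_mem v hx)
    rwa [hv_one_tmul_smul, algebraMap_smul] at this
  obtain ⟨a, ha, ha0⟩ := exists_ne_zero_mem v
  have hM : IsZLat M := (isZLat_of_between ha0 hMM' (hpM a ha)).2 hM'
  have hMv : (latCompletion v M : Set _) = ⇑g '' (latCompletion v L : Set _) := by
    apply Set.Subset.antisymm
    · intro w hw
      refine latC_induction v M (P := fun w => w ∈ ⇑g '' (latCompletion v L : Set _))
        ?_ ?_ ?_ ?_ hw
      · exact ⟨0, zero_mem _, map_zero _⟩
      · rintro _ _ ⟨x, hx, rfl⟩ ⟨y, hy, rfl⟩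
        exact ⟨x + y, add_mem hx hy, map_add _ _ _⟩
      · rintro c _ hc ⟨x, hx, rfl⟩
        exact ⟨c • x, latC_smul v L hc hx, map_smul _ _ _⟩
      · intro x hx; exact hx.2
    · rintro w hw
      have hwM' : w ∈ latCompletion v M' := by
        have : w ∈ (latCompletion v M' : Set _) := by
          rw [← hgL]
          exact Set.image_mono (latC_mono v (le_rhoK Φ _ L)) hw
        exact this
      obtain ⟨m, hm, z, hz, rfl⟩ := latC_dense v M' ha0 hwM'
      refine add_mem (latC_of_mem v ⟨hm, ?_⟩) ?_
      · obtain ⟨x, hx, hxw⟩ := hw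
        obtain ⟨y, hy, hyz⟩ := haloc a ha z hz
        refine ⟨x - y, sub_mem hx hy, ?_⟩
        rw [map_sub, hxw, hyz, add_sub_cancel_right]
      · refine latC_induction v _ (P := fun u => algebraMap K (v.adicCompletion K)
          (algebraMap (𝓞 K) K a) • u ∈ latCompletion v M) ?_ ?_ ?_ ?_ hz
        · simp
        · intro x y hx hy; rw [smul_add]; exact add_mem hx hy
        · intro c x hc hx; rw [smul_comm]; exact latC_smul v M hc hx
        · intro x hx
          rw [hv_one_tmul_smul, algebraMap_smul]
          exact latC_of_mem v (hpM a ha x hx)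
  have hrv : latCompletion v (rhoK Φ v.asIdeal M) = latCompletion v M' := by
    apply SetLike.coe_injective
    rw [latC_rhoK Φ v hM, hMv, rhoLoc_image Φ v _ g hg, ← latC_rhoK Φ v hL, hgL]
  refine ⟨M, hM, ?_, ?_⟩
  · intro w
    by_cases hw : w = v
    · subst hw
      exact ⟨g, hg, fun _ => hMv.symm⟩
    · obtain ⟨g', hg', hgL'⟩ := h w
      refine ⟨g', hg', fun i => ?_⟩
      have hgL' := hgL' i
      simp only at hgL' ⊢
      obtain ⟨b, hb, hbw⟩ := exists_mem_notMem hw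
      rw [latC_rhoK_away Φ hw, hgL', latC_eq_of_between w hbw hMM' (hpM b hb)]
  · apply le_antisymm
    · intro x hx
      refine mem_of_latC v hM' (fun b hb => hMM' (smul_rhoK Φ v.ne_bot hb hx)) ?_
      rw [← hrv]; exact latC_of_mem v hx
    · intro x hx
      refine mem_of_latC v (isZLat_rhoK Φ v hM) (fun b hb => le_rhoK Φ _ M (hpM b hb x hx)) ?_
      rw [hrv]; exact latC_of_mem v hx

lemma rhoK_image (Φ : LinearMap.BilinForm K V) {p : Ideal (𝓞 K)} (hp : p ≠ ⊥)
    {L M : Submodule (𝓞 K) V} (g : V ≃ₗ[K] V) (hg : ∀ x y, Φ (g x) (g y) = Φ x y)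
    (h : ⇑g '' (L : Set V) = (M : Set V)) :
    ⇑g '' (rhoK Φ p L : Set V) = (rhoK Φ p M : Set V) := by
  have hmem : ∀ x, g x ∈ M ↔ x ∈ L := by
    intro x
    have : g x ∈ (M : Set V) ↔ x ∈ (L : Set V) := by
      rw [← h]; exact g.injective.mem_set_image
    exact this
  have hall : ∀ P : V → Prop, (∀ n ∈ M, P n) ↔ ∀ n ∈ L, P (g n) := by
    intro P
    constructor
    · intro H n hn; exact H _ ((hmem n).2 hn)
    · intro H n hn
      obtain ⟨n, rfl⟩ := g.surjective n
      exact H n ((hmem n).1 hn)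
  have hsm : ∀ (a : 𝓞 K) x, a • g x = g (a • x) := by
    intro a x
    rw [← algebraMap_smul K a, ← algebraMap_smul K a x, map_smul]
  have key : ∀ x, g x ∈ rhoK Φ p M ↔ x ∈ rhoK Φ p L := by
    intro x
    rw [mem_rhoK_iff Φ hp, mem_rhoK_iff Φ hp]
    constructor
    · rintro ⟨l, hl, e, ⟨h1, h2⟩, he⟩
      obtain ⟨l, rfl⟩ := g.surjective l
      obtain ⟨e, rfl⟩ := g.surjective e
      refine ⟨l, (hmem l).1 hl, e, ⟨fun a ha => ?_, fun n hn => ?_⟩, ?_⟩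
      · have := h1 a ha
        rwa [hsm, hmem] at this
      · rw [← hg]; exact h2 _ ((hmem n).2 hn)
      · rw [← map_add] at he; exact g.injective he
    · rintro ⟨l, hl, e, ⟨h1, h2⟩, rfl⟩
      refine ⟨g l, (hmem l).2 hl, g e, ⟨fun a ha => ?_, ?_⟩, (map_add _ _ _).symm⟩
      · rw [hsm, hmem]; exact h1 a ha
      · rw [hall]; intro n hn; rw [hg]; exact h2 n hn
  ext y
  obtain ⟨x, rfl⟩ := g.surjective y
  exact g.injective.mem_set_image.trans (key x).symm

lemma isIsom_equivalence (Φ : LinearMap.BilinForm K V) {ι : Type*} :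
    Equivalence (IsIsom (ι := ι) Φ) := by
  refine ⟨fun L => ⟨LinearEquiv.refl K V, fun _ _ => rfl, fun i => Set.image_id _⟩, ?_, ?_⟩
  · rintro L M ⟨g, hg, h⟩
    refine ⟨g.symm, fun x y => ?_, fun i => ?_⟩
    · rw [← hg]; simp
    · rw [← h i]
      ext x
      simp [Set.image_image]
  · rintro L M N ⟨g, hg, h⟩ ⟨g', hg', h'⟩
    refine ⟨g.trans g', fun x y => by simp [hg, hg'], fun i => ?_⟩
    rw [← h' i, ← h i, Set.image_image]
    rfl

lemma finite_between_s11 {N : Submodule (𝓞 K) V} (hN : N.FG) {a : 𝓞 K} (ha : a ≠ 0) :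
    {M : Submodule (𝓞 K) V | M ≤ N ∧ ∀ x ∈ N, a • x ∈ M}.Finite := by
  classical
  obtain ⟨n, f, hf⟩ := Submodule.fg_iff_exists_fin_generating_family.1 hN
  have hfin : Finite (𝓞 K ⧸ Ideal.span {a}) :=
    Ring.HasFiniteQuotients.finiteQuotient (by simpa using ha)
  have hfN : ∀ i, f i ∈ N := fun i => hf ▸ Submodule.subset_span ⟨i, rfl⟩
  let F : Submodule (𝓞 K) V → Set (Fin n → 𝓞 K ⧸ Ideal.span {a}) := fun M =>
    {c | ∑ i, (Quotient.out (c i)) • f i ∈ M}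
  refine Set.Finite.of_injOn (f := F) (t := Set.univ) (fun _ _ => Set.mem_univ _) ?_
    Set.finite_univ
  have key : ∀ M M' : Submodule (𝓞 K) V, (M ≤ N ∧ ∀ x ∈ N, a • x ∈ M) →
      (M' ≤ N ∧ ∀ x ∈ N, a • x ∈ M') → F M = F M' → M ≤ M' := by
    rintro M M' ⟨hM1, hM2⟩ ⟨hM1', hM2'⟩ hF x hx
    have hxN := hM1 hx
    rw [← hf, Submodule.mem_span_range_iff_exists_fun] at hxN
    obtain ⟨c, rfl⟩ := hxN
    have hdiff : ∀ i, ∃ t, c i = Quotient.out (Ideal.Quotient.mk (Ideal.span {a}) (c i)) + a * t := by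
      intro i
      have h1 : Ideal.Quotient.mk (Ideal.span {a}) (c i) = Ideal.Quotient.mk (Ideal.span {a})
          (Quotient.out (Ideal.Quotient.mk (Ideal.span {a}) (c i))) :=
        (Quotient.out_eq (Ideal.Quotient.mk (Ideal.span {a}) (c i))).symm
      rw [Ideal.Quotient.eq, Ideal.mem_span_singleton] at h1
      obtain ⟨t, ht⟩ := h1
      exact ⟨t, by rw [← ht]; ring⟩
    choose t ht using hdiff
    have hsum : ∑ i, c i • f i = ∑ i, (Quotient.out
        (Ideal.Quotient.mk (Ideal.span {a}) (c i))) • f i + a • ∑ i, t i • f i := by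
      rw [Finset.smul_sum, ← Finset.sum_add_distrib]
      refine Finset.sum_congr rfl fun i _ => ?_
      rw [smul_smul, ← add_smul, ← ht i]
    have htN : ∑ i, t i • f i ∈ N := sum_mem fun i _ => N.smul_mem _ (hfN i)
    have hcF : (fun i => Ideal.Quotient.mk (Ideal.span {a}) (c i)) ∈ F M := by
      change ∑ i, _ • f i ∈ M
      rw [hsum] at hx
      exact (Submodule.add_mem_iff_left M (hM2 _ htN)).1 hx
    rw [hF] at hcF
    rw [hsum]
    exact add_mem hcF (hM2' _ htN)
  intro M hM M' hM' hF
  exact le_antisymm (key M M' hM hM' hF) (key M' M hM' hM hF.symm)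

end helpers

theorem classNumber_rhoK_le
    [FiniteDimensional K V]
    (Φ : LinearMap.BilinForm K V)
    (hsymm : ∀ x y : V, Φ x y = Φ y x)
    (hnd : ∀ x : V, (∀ y : V, Φ x y = 0) → x = 0)
    (L : Submodule (𝓞 K) V) (hL : IsZLat L)
    (p : Ideal (𝓞 K)) (hp : p.IsMaximal) :
    classNumber Φ (fun _ : Fin 1 => rhoK Φ p L) ≤
      classNumber Φ (fun _ : Fin 1 => L) := by

  classical
  have hpne : p ≠ ⊥ := (Ideal.bot_lt_of_maximal p (RingOfIntegers.not_isField K)).ne'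
  obtain ⟨v, rfl⟩ : ∃ v : HeightOneSpectrum (𝓞 K), v.asIdeal = p := ⟨⟨p, hp.isPrime, hpne⟩, rfl⟩
  have hconst : ∀ X : Fin 1 → Submodule (𝓞 K) V, (fun _ => X 0) = X := by
    intro X; funext i; rw [Subsingleton.elim i 0]
  let A := genusSet Φ (fun _ : Fin 1 => L)
  let B := genusSet Φ (fun _ : Fin 1 => rhoK Φ v.asIdeal L)
  let F : A → B := fun X => ⟨fun _ => rhoK Φ v.asIdeal (X.1 0),
    fun _ => isZLat_rhoK Φ v (X.2.1 0),
    sameGenus_rhoK Φ v hL (X.2.1 0) (by rw [hconst X.1]; exact X.2.2)⟩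
  have hF : Function.Surjective F := by
    rintro ⟨Y, hY1, hY2⟩
    obtain ⟨M, hM1, hM2, hM3⟩ := exists_rhoK_eq Φ v hL (hY1 0) (by rw [hconst Y]; exact hY2)
    refine ⟨⟨fun _ => M, fun _ => hM1, hM2⟩, Subtype.ext ?_⟩
    change (fun _ => rhoK Φ v.asIdeal M) = Y
    rw [hM3, hconst]
  let rA : A → A → Prop := fun X Y => IsIsom Φ X.1 Y.1
  let rB : B → B → Prop := fun X Y => IsIsom Φ X.1 Y.1
  have hFr : ∀ X Y, rA X Y → rB (F X) (F Y) := by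
    rintro X Y ⟨g, hg, h⟩
    exact ⟨g, hg, fun _ => rhoK_image Φ v.ne_bot g hg (h 0)⟩
  let f : Quot rA → Quot rB := Quot.map F hFr
  have hf : Function.Surjective f := by
    intro y
    obtain ⟨Y, rfl⟩ := Quot.exists_rep y
    obtain ⟨X, rfl⟩ := hF Y
    exact ⟨Quot.mk _ X, rfl⟩
  change Nat.card (Quot rB) ≤ Nat.card (Quot rA)
  by_cases hAfin : Finite (Quot rA)
  · exact Nat.card_le_card_of_surjective f hf
  · have hBinf : ¬ Finite (Quot rB) := by
      intro hB
      apply hAfin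
      rw [← Set.finite_univ_iff, ← Set.preimage_univ (f := f)]
      refine Set.Finite.preimage' Set.finite_univ fun y _ => ?_
      obtain ⟨Y, rfl⟩ := Quot.exists_rep y
      obtain ⟨a, ha, ha0⟩ := exists_ne_zero_mem v
      have hfin := finite_between_s11 (N := Y.1 0) (Y.2.1 0).1 ha0
      have hEq : Equivalence rB := (isIsom_equivalence Φ).comap Subtype.val
      have hex : ∀ x : Quot rA, ∃ M : Submodule (𝓞 K) V, x ∈ f ⁻¹' {Quot.mk rB Y} →
          (M ≤ Y.1 0 ∧ ∀ y ∈ Y.1 0, a • y ∈ M) ∧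
          ∃ X : A, Quot.mk rA X = x ∧ IsIsom Φ X.1 (fun _ => M) := by
        intro x
        obtain ⟨X, rfl⟩ := Quot.exists_rep x
        by_cases hx : Quot.mk rA X ∈ f ⁻¹' {Quot.mk rB Y}
        swap
        · exact ⟨⊥, fun h => absurd h hx⟩
        have hXY : rB (F X) Y := hEq.eqvGen_iff.1 (Quot.eqvGen_exact hx)
        obtain ⟨g, hg, h⟩ := hXY
        have h0 : ⇑g '' (rhoK Φ v.asIdeal (X.1 0) : Set V) = (Y.1 0 : Set V) := h 0
        refine ⟨(X.1 0).map (g.toLinearMap.restrictScalars (𝓞 K)), fun _ => ⟨⟨?_, ?_⟩, X, rfl, g,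
          hg, ?_⟩⟩
        · rintro _ ⟨z, hz, rfl⟩
          have : g z ∈ (Y.1 0 : Set V) := by
            rw [← h0]; exact ⟨z, le_rhoK Φ _ _ hz, rfl⟩
          exact this
        · intro y hy
          have hy' : y ∈ (Y.1 0 : Set V) := hy
          rw [← h0] at hy'
          obtain ⟨z, hz, rfl⟩ := hy'
          refine ⟨a • z, smul_rhoK Φ v.ne_bot ha hz, ?_⟩
          exact map_smul (g.toLinearMap.restrictScalars (𝓞 K)) a z
        · intro i
          rw [Subsingleton.elim i 0]
          rfl
      choose G hG using hex
      refine Set.Finite.of_injOn (f := G) (fun x hx => (hG x hx).1) ?_ hfin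
      intro x hx x' hx' hxx'
      obtain ⟨X, rfl, hX⟩ := (hG x hx).2
      obtain ⟨X', rfl, hX'⟩ := (hG x' hx').2
      rw [← hxx'] at hX'
      exact Quot.sound ((isIsom_equivalence Φ).trans hX ((isIsom_equivalence Φ).symm hX'))
    have : Infinite (Quot rB) := not_finite_iff_infinite.1 hBinf
    rw [Nat.card_eq_zero_of_infinite]
    exact Nat.zero_le _
end
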